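/- arXiv:math/0211268 — 2 statements merged into one kernel-verified Lean document; each statement's English description precedes it below -/
import Mathlib

section
/- For every integer n ≥ 1, the number of unimodular triangulations of the rectangle [0,1]×[0,n] equals the central binomial coefficient C(2n, n), i.e., f(1,n) = (2n choose n). -/
open Set

noncomputable section

/-- A point of the integer lattice `ℤ² ⊆ ℝ²`. -/
def IsLatticePoint (p : ℝ × ℝ) : Prop := ∃ a b : ℤ, p = ((a : ℝ), (b : ℝ))

/-- A triangle: the convex hull of three affinely independent points of `ℝ²`. -/
def IsTriangle (Δ : Set (ℝ × ℝ)) : Prop :=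
  ∃ p q r : ℝ × ℝ, AffineIndependent ℝ ![p, q, r] ∧ Δ = convexHull ℝ {p, q, r}

/-- `F` is a face of the triangle `Δ`: the empty set, a vertex, an edge,
or the whole triangle. -/
def IsFaceOf (F Δ : Set (ℝ × ℝ)) : Prop :=
  ∃ p q r : ℝ × ℝ, AffineIndependent ℝ ![p, q, r] ∧ Δ = convexHull ℝ {p, q, r} ∧
    (F = ∅ ∨ F = {p} ∨ F = {q} ∨ F = {r} ∨
     F = segment ℝ p q ∨ F = segment ℝ q r ∨ F = segment ℝ p r ∨ F = Δ)

/-- The determinant of the two edge vectors of the triangle `pqr` emanating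
from `p`; its absolute value is twice the Euclidean area of the triangle. -/
def triDet (p q r : ℝ × ℝ) : ℝ :=
  (q.1 - p.1) * (r.2 - p.2) - (q.2 - p.2) * (r.1 - p.1)

/-- A unimodular triangle: a lattice triangle of area `1/2`. -/
def IsUnimodularTriangle (Δ : Set (ℝ × ℝ)) : Prop :=
  ∃ p q r : ℝ × ℝ, IsLatticePoint p ∧ IsLatticePoint q ∧ IsLatticePoint r ∧
    AffineIndependent ℝ ![p, q, r] ∧ Δ = convexHull ℝ {p, q, r} ∧
    |triDet p q r| = 1

/-- `T` is a unimodular triangulation of the region `P`. -/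
def IsUnimodularTriangulation (P : Set (ℝ × ℝ)) (T : Set (Set (ℝ × ℝ))) : Prop :=
  T.Finite ∧ (∀ Δ ∈ T, IsUnimodularTriangle Δ ∧ Δ ⊆ P) ∧ ⋃₀ T = P ∧
  ∀ Δ₁ ∈ T, ∀ Δ₂ ∈ T, IsFaceOf (Δ₁ ∩ Δ₂) Δ₁ ∧ IsFaceOf (Δ₁ ∩ Δ₂) Δ₂

/-- The number of unimodular triangulations of the region `P`. -/
def numTriangulations (P : Set (ℝ × ℝ)) : ℕ :=
  Set.ncard {T | IsUnimodularTriangulation P T}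

/-- `f m n` is the number of unimodular triangulations of `[0,m] × [0,n]`. -/
def f (m n : ℕ) : ℕ :=
  numTriangulations (Set.Icc (0, 0) ((m : ℝ), (n : ℝ)))

/-- `Δ₂` lies above `Δ₁` (written `Δ₁ ≺ Δ₂`). -/
def LiesAbove (Δ₁ Δ₂ : Set (ℝ × ℝ)) : Prop :=
  ∃ x y₁ y₂ : ℝ, (x, y₁) ∈ Δ₁ \ Δ₂ ∧ (x, y₂) ∈ Δ₂ \ Δ₁ ∧ y₁ < y₂

theorem triDet_rotate (p q r : ℝ × ℝ) : triDet q r p = triDet p q r := by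
  unfold triDet; ring

theorem triDet_swap (p q r : ℝ × ℝ) : triDet p r q = -triDet p q r := by
  unfold triDet; ring

theorem affineIndependent_iff_triDet_ne_zero (p q r : ℝ × ℝ) :
    AffineIndependent ℝ ![p, q, r] ↔ triDet p q r ≠ 0 := by
  rw [affineIndependent_iff_not_collinear_set, not_iff_not,
    collinear_iff_of_mem (Set.mem_insert p _)]
  constructor
  · rintro ⟨v, hv⟩
    obtain ⟨s, rfl⟩ := hv q (by simp)
    obtain ⟨t, rfl⟩ := hv r (by simp)
    simp only [triDet, vadd_eq_add, Prod.fst_add, Prod.snd_add, Prod.smul_fst, Prod.smul_snd,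
      smul_eq_mul]
    ring
  · intro h
    by_cases hqp : q = p
    · subst hqp
      refine ⟨r - q, ?_⟩
      rintro x (rfl | rfl | rfl)
      · exact ⟨0, by simp⟩
      · exact ⟨0, by simp⟩
      · exact ⟨1, by simp⟩
    · refine ⟨q - p, ?_⟩
      rintro x (rfl | rfl | rfl)
      · exact ⟨0, by simp⟩
      · exact ⟨1, by simp⟩
      · have hpos : (q.1 - p.1) ^ 2 + (q.2 - p.2) ^ 2 ≠ 0 := by
          intro h0
          apply hqp
          ext <;> nlinarith [sq_nonneg (q.1 - p.1), sq_nonneg (q.2 - p.2)]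
        refine ⟨((x.1 - p.1) * (q.1 - p.1) + (x.2 - p.2) * (q.2 - p.2)) /
          ((q.1 - p.1) ^ 2 + (q.2 - p.2) ^ 2), ?_⟩
        unfold triDet at h
        ext
        · simp only [vadd_eq_add, Prod.fst_add, Prod.smul_fst, Prod.fst_sub, smul_eq_mul]
          field_simp
          linear_combination (-(q.2 - p.2)) * h
        · simp only [vadd_eq_add, Prod.snd_add, Prod.smul_snd, Prod.snd_sub, smul_eq_mul]
          field_simp
          linear_combination (q.1 - p.1) * h

theorem mem_convexHull_triple {p q r x : ℝ × ℝ} :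
    x ∈ convexHull ℝ {p, q, r} ↔ ∃ u v w : ℝ, 0 ≤ u ∧ 0 ≤ v ∧ 0 ≤ w ∧ u + v + w = 1 ∧
      x = u • p + v • q + w • r := by
  constructor
  · rw [convexHull_insert (by simp), convexHull_pair, convexJoin_singleton_left]
    simp only [mem_iUnion, segment, mem_ofPred_eq]
    rintro ⟨_, ⟨s, t, hs, ht, hst, rfl⟩, a, b, ha, hb, hab, rfl⟩
    refine ⟨a, b * s, b * t, ha, by positivity, by positivity,
      by linear_combination hab + b * hst, ?_⟩
    simp only [smul_add, smul_smul, add_assoc]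
  · rintro ⟨u, v, w, hu, hv, hw, h, rfl⟩
    have hp : p ∈ convexHull ℝ {p, q, r} := subset_convexHull ℝ _ (by simp)
    have hq : q ∈ convexHull ℝ {p, q, r} := subset_convexHull ℝ _ (by simp)
    have hr : r ∈ convexHull ℝ {p, q, r} := subset_convexHull ℝ _ (by simp)
    have := (convex_convexHull ℝ {p, q, r}).sum_mem (t := Finset.univ) (w := ![u, v, w])
      (z := ![p, q, r]) (by simp [Fin.forall_fin_succ, hu, hv, hw])
      (by simp [Fin.sum_univ_three, h]) (by simp [Fin.forall_fin_succ, hp, hq, hr])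
    simpa [Fin.sum_univ_three] using this

/-- An edge is the zero locus in the triangle of the barycentric coordinate of the opposite
vertex. -/
theorem isExtreme_convexHull_segment {p q r : ℝ × ℝ} (h : triDet p q r ≠ 0) :
    IsExtreme ℝ (convexHull ℝ {p, q, r}) (segment ℝ p q) := by
  have hsub : segment ℝ p q ⊆ convexHull ℝ {p, q, r} := by
    rw [← convexHull_pair]
    exact convexHull_mono (by grind)
  have hcoord : ∀ u v w : ℝ, u + v + w = 1 →
      triDet p q (u • p + v • q + w • r) = w * triDet p q r := by
    intro u v w huvw
    obtain rfl : u = 1 - v - w := by linarith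
    simp only [triDet, Prod.fst_add, Prod.snd_add, Prod.smul_fst, Prod.smul_snd, smul_eq_mul]
    ring
  have hseg : ∀ x ∈ segment ℝ p q, triDet p q x = 0 := by
    rintro _ ⟨a, b, ha, hb, hab, rfl⟩
    have := hcoord a b 0 (by linarith)
    simpa using this
  refine ⟨hsub, fun x hx y hy z hz hxyz => ?_⟩
  obtain ⟨u, v, w, hu, hv, hw, huvw, rfl⟩ := mem_convexHull_triple.1 hx
  obtain ⟨u', v', w', hu', hv', hw', huvw', rfl⟩ := mem_convexHull_triple.1 hy
  obtain ⟨a, b, ha, hb, hab, rfl⟩ := hxyz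
  have h0 := hseg _ hz
  have e : a • (u • p + v • q + w • r) + b • (u' • p + v' • q + w' • r) =
      (a * u + b * u') • p + (a * v + b * v') • q + (a * w + b * w') • r := by module
  rw [e, hcoord _ _ _ (by linear_combination a * huvw + b * huvw' + hab)] at h0
  have h1 : a * w + b * w' = 0 := (mul_eq_zero.1 h0).resolve_right h
  have h2 : w = 0 := by
    have := mul_nonneg ha.le hw
    have := mul_nonneg hb.le hw'
    exact (mul_eq_zero.1 (by linarith : a * w = 0)).resolve_left ha.ne'
  exact ⟨u, v, hu, hv, by linarith, by simp [h2]⟩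

theorem segment_inter_segment {p q r : ℝ × ℝ} (h : triDet p q r ≠ 0) :
    segment ℝ p q ∩ segment ℝ p r = {p} := by
  apply Subset.antisymm
  · rintro _ ⟨⟨a, b, ha, hb, hab, rfl⟩, ⟨c, d, hc, hd, hcd, he⟩⟩
    have h0 : d * triDet p q r = 0 := by
      obtain rfl : c = 1 - d := by linarith
      obtain rfl : a = 1 - b := by linarith
      have h1 := congrArg Prod.fst he
      have h2 := congrArg Prod.snd he
      simp only [Prod.fst_add, Prod.snd_add, Prod.smul_fst, Prod.smul_snd, smul_eq_mul] at h1 h2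
      unfold triDet
      linear_combination (q.1 - p.1) * h2 - (q.2 - p.2) * h1
    obtain rfl : d = 0 := (mul_eq_zero.1 h0).resolve_right h
    obtain rfl : c = 1 := by linarith
    simpa using he.symm
  · rintro _ rfl
    exact ⟨left_mem_segment ℝ _ _, left_mem_segment ℝ _ _⟩

theorem IsFaceOf.isExtreme {F Δ : Set (ℝ × ℝ)} (h : IsFaceOf F Δ) : IsExtreme ℝ Δ F := by
  obtain ⟨p, q, r, hi, rfl, hF⟩ := h
  rw [affineIndependent_iff_triDet_ne_zero] at hi
  have edge : ∀ p' q' r', triDet p' q' r' ≠ 0 → ({p', q', r'} : Set (ℝ × ℝ)) = {p, q, r} →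
      IsExtreme ℝ (convexHull ℝ {p, q, r}) (segment ℝ p' q') := by
    intro p' q' r' hne he
    exact he ▸ isExtreme_convexHull_segment hne
  have vertex : ∀ p' q' r', triDet p' q' r' ≠ 0 → ({p', q', r'} : Set (ℝ × ℝ)) = {p, q, r} →
      IsExtreme ℝ (convexHull ℝ {p, q, r}) {p'} := by
    intro p' q' r' hne he
    rw [← segment_inter_segment hne]
    refine (edge _ _ _ hne he).inter (edge p' r' q' ?_ ?_)
    · rwa [triDet_swap, neg_ne_zero]
    · rw [← he, Set.pair_comm]
  have hqrp : triDet q r p ≠ 0 := by rwa [triDet_rotate]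
  have hrpq : triDet r p q ≠ 0 := by rwa [triDet_rotate]
  have hprq : triDet p r q ≠ 0 := by rwa [triDet_swap, neg_ne_zero]
  rcases hF with rfl | rfl | rfl | rfl | rfl | rfl | rfl | rfl
  · exact ⟨empty_subset _, fun _ _ _ _ _ hz => hz.elim⟩
  · exact vertex p q r hi rfl
  · exact vertex q r p hqrp (by grind)
  · exact vertex r p q hrpq (by grind)
  · exact edge p q r hi rfl
  · exact edge q r p hqrp (by grind)
  · exact edge p r q hprq (by grind)
  · exact IsExtreme.rfl

/-- The part of the vertical strip `0 ≤ x ≤ 1` between the segment from `(0, a)` to `(1, b)` and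
the segment from `(0, c)` to `(1, d)`. -/
def slab (a b c d : ℝ) : Set (ℝ × ℝ) :=
  {p | 0 ≤ p.1 ∧ p.1 ≤ 1 ∧ (1 - p.1) * a + p.1 * b ≤ p.2 ∧ p.2 ≤ (1 - p.1) * c + p.1 * d}

theorem slab_left_eq (a b : ℝ) :
    slab a b (a + 1) b = convexHull ℝ {(0, a), (1, b), (0, a + 1)} := by
  ext ⟨x, y⟩
  simp only [slab, mem_ofPred_eq, mem_convexHull_triple, Prod.smul_mk, smul_eq_mul, Prod.mk_add_mk,
    Prod.mk.injEq]
  constructor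
  · rintro ⟨h0, h1, h2, h3⟩
    exact ⟨1 - x - (y - (1 - x) * a - x * b), x, y - (1 - x) * a - x * b, by linarith, h0,
      by linarith, by ring, by ring, by ring⟩
  · rintro ⟨u, v, w, hu, hv, hw, h, rfl, rfl⟩
    obtain rfl : u = 1 - v - w := by linarith
    refine ⟨by linarith, by linarith, by linarith, by linarith⟩

theorem slab_right_eq (a b : ℝ) :
    slab a b a (b + 1) = convexHull ℝ {(0, a), (1, b), (1, b + 1)} := by
  ext ⟨x, y⟩
  simp only [slab, mem_ofPred_eq, mem_convexHull_triple, Prod.smul_mk, smul_eq_mul, Prod.mk_add_mk,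
    Prod.mk.injEq]
  constructor
  · rintro ⟨h0, h1, h2, h3⟩
    exact ⟨1 - x, x - (y - (1 - x) * a - x * b), y - (1 - x) * a - x * b, by linarith,
      by linarith, by linarith, by ring, by ring, by ring⟩
  · rintro ⟨u, v, w, hu, hv, hw, h, rfl, rfl⟩
    obtain rfl : u = 1 - v - w := by linarith
    refine ⟨by linarith, by linarith, by linarith, by linarith⟩

/-- `(c, d)` is obtained from `(a, b)` by adding one to exactly one coordinate. -/
def IsStep (a b c d : ℕ) : Prop := (c = a + 1 ∧ d = b) ∨ (c = a ∧ d = b + 1)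

theorem IsStep.exists_third_vertex {a b c d : ℕ} (h : IsStep a b c d) :
    ∃ r : ℝ × ℝ, IsLatticePoint r ∧ |triDet (0, (a : ℝ)) (1, (b : ℝ)) r| = 1 ∧
      slab a b c d = convexHull ℝ {(0, (a : ℝ)), (1, (b : ℝ)), r} ∧
      ((r = (0, (c : ℝ)) ∧ (1, (d : ℝ)) = ((1, b) : ℝ × ℝ)) ∨
        (r = (1, (d : ℝ)) ∧ (0, (c : ℝ)) = ((0, a) : ℝ × ℝ))) := by
  rcases h with ⟨rfl, rfl⟩ | ⟨rfl, rfl⟩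
  · refine ⟨(0, (a : ℝ) + 1), ⟨0, a + 1, by simp⟩, by simp [triDet], ?_, .inl (by simp)⟩
    rw [← slab_left_eq]; push_cast; rfl
  · refine ⟨(1, (b : ℝ) + 1), ⟨1, b + 1, by simp⟩, by simp [triDet], ?_, .inr (by simp)⟩
    rw [← slab_right_eq]; push_cast; rfl

theorem IsStep.isUnimodularTriangle {a b c d : ℕ} (h : IsStep a b c d) :
    IsUnimodularTriangle (slab a b c d) := by
  obtain ⟨r, hr, hdet, he, -⟩ := h.exists_third_vertex
  refine ⟨_, _, r, ⟨0, a, by simp⟩, ⟨1, b, by simp⟩, hr, ?_, he, hdet⟩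
  rw [affineIndependent_iff_triDet_ne_zero]
  intro h0
  simp [h0] at hdet

/-- `F` is a face of the segment from `(0, a)` to `(1, b)`. -/
def IsEdgeFace (a b : ℝ) (F : Set (ℝ × ℝ)) : Prop :=
  F = ∅ ∨ F = {(0, a)} ∨ F = {(1, b)} ∨ F = segment ℝ (0, a) (1, b)

theorem IsStep.isFaceOf {a b c d : ℕ} (h : IsStep a b c d) {F : Set (ℝ × ℝ)}
    (hF : IsEdgeFace a b F ∨ IsEdgeFace c d F ∨ F = slab a b c d) :
    IsFaceOf F (slab a b c d) := by
  obtain ⟨r, hr, hdet, he, hcd⟩ := h.exists_third_vertex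
  refine ⟨_, _, r, ?_, he, ?_⟩
  · rw [affineIndependent_iff_triDet_ne_zero]
    intro h0
    simp [h0] at hdet
  · unfold IsEdgeFace at hF
    rcases hcd with ⟨rfl, h2⟩ | ⟨rfl, h2⟩
    · rw [h2, segment_symm ℝ (0, (c : ℝ))] at hF
      tauto
    · rw [h2] at hF
      tauto

theorem slab_inter_slab {a b c d a' b' c' d' : ℝ} (h₁ : c ≤ a') (h₂ : d ≤ b')
    (h₃ : a ≤ c) (h₄ : b ≤ d) (h₅ : a' ≤ c') (h₆ : b' ≤ d') :
    IsEdgeFace c d (slab a b c d ∩ slab a' b' c' d') ∧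
      IsEdgeFace a' b' (slab a b c d ∩ slab a' b' c' d') := by
  have key : ∀ x y : ℝ, (x, y) ∈ slab a b c d ∩ slab a' b' c' d' ↔
      0 ≤ x ∧ x ≤ 1 ∧ y = (1 - x) * c + x * d ∧ (1 - x) * (a' - c) = 0 ∧ x * (b' - d) = 0 := by
    intro x y
    simp only [slab, mem_inter_iff, mem_ofPred_eq]
    constructor
    · rintro ⟨⟨h0, h1, -, h7⟩, -, -, h8, -⟩
      have := mul_nonneg (sub_nonneg.2 h1) (sub_nonneg.2 h₁)
      have := mul_nonneg h0 (sub_nonneg.2 h₂)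
      exact ⟨h0, h1, by linarith, by linarith, by linarith⟩
    · rintro ⟨h0, h1, rfl, h7, h8⟩
      have := mul_nonneg (sub_nonneg.2 h1) (sub_nonneg.2 h₃)
      have := mul_nonneg h0 (sub_nonneg.2 h₄)
      have := mul_nonneg (sub_nonneg.2 h1) (sub_nonneg.2 h₅)
      have := mul_nonneg h0 (sub_nonneg.2 h₆)
      exact ⟨⟨h0, h1, by linarith, by linarith⟩, h0, h1, by linarith, by linarith⟩
  generalize slab a b c d ∩ slab a' b' c' d' = F at key
  unfold IsEdgeFace
  rcases h₁.eq_or_lt with rfl | h₁ <;> rcases h₂.eq_or_lt with rfl | h₂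
  · suffices F = segment ℝ (0, c) (1, d) by tauto
    ext ⟨x, y⟩
    rw [key]
    constructor
    · rintro ⟨h0, h1, rfl, -, -⟩
      exact ⟨1 - x, x, by linarith, h0, by ring, by simp⟩
    · rintro ⟨u, v, hu, hv, huv, he⟩
      simp only [Prod.smul_mk, smul_eq_mul, Prod.mk_add_mk, Prod.mk.injEq] at he
      obtain ⟨rfl, rfl⟩ := he
      obtain rfl : u = 1 - v := by linarith
      exact ⟨by linarith, by linarith, by ring, by ring, by ring⟩
  · suffices F = {(0, c)} by tauto
    ext ⟨x, y⟩
    rw [key, mem_singleton_iff, Prod.mk.injEq]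
    constructor
    · rintro ⟨h0, h1, rfl, -, h2⟩
      obtain rfl : x = 0 := (mul_eq_zero.1 h2).resolve_right (by linarith)
      simp
    · rintro ⟨rfl, rfl⟩
      simp
  · suffices F = {(1, d)} by tauto
    ext ⟨x, y⟩
    rw [key, mem_singleton_iff, Prod.mk.injEq]
    constructor
    · rintro ⟨h0, h1, rfl, h2, -⟩
      obtain rfl : x = 1 := by
        have := (mul_eq_zero.1 h2).resolve_right (by linarith)
        linarith
      simp
    · rintro ⟨rfl, rfl⟩
      simp
  · suffices F = ∅ by tauto
    ext ⟨x, y⟩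
    rw [key, mem_empty_iff_false, iff_false]
    rintro ⟨-, -, -, h2, h3⟩
    have := (mul_eq_zero.1 h2).resolve_right (by linarith)
    have := (mul_eq_zero.1 h3).resolve_right (by linarith)
    linarith

theorem zero_mk_mem_slab {a b c d y : ℝ} : (0, y) ∈ slab a b c d ↔ a ≤ y ∧ y ≤ c := by
  simp [slab]

theorem one_mk_mem_slab {a b c d y : ℝ} : (1, y) ∈ slab a b c d ↔ b ≤ y ∧ y ≤ d := by
  simp [slab]

theorem half_mk_mem_slab {a b c d y : ℝ} :
    (1 / 2, y) ∈ slab a b c d ↔ a + b ≤ 2 * y ∧ 2 * y ≤ c + d := by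
  simp only [slab, mem_ofPred_eq]
  constructor
  · rintro ⟨-, -, h1, h2⟩
    constructor <;> linarith
  · rintro ⟨h1, h2⟩
    refine ⟨by norm_num, by norm_num, by linarith, by linarith⟩

theorem exists_eq_slab {n : ℕ} {Δ : Set (ℝ × ℝ)} (h : IsUnimodularTriangle Δ)
    (hΔ : Δ ⊆ Icc (0, 0) (1, (n : ℝ))) :
    ∃ a b c d : ℕ, IsStep a b c d ∧ c ≤ n ∧ d ≤ n ∧ Δ = slab a b c d := by
  obtain ⟨p, q, r, hp, hq, hr, -, rfl, hdet⟩ := h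
  have lattice : ∀ z ∈ ({p, q, r} : Set (ℝ × ℝ)), IsLatticePoint z →
      ∃ j : ℕ, j ≤ n ∧ (z = (0, (j : ℝ)) ∨ z = (1, (j : ℝ))) := by
    rintro z hz ⟨x, y, rfl⟩
    obtain ⟨⟨hx0, hy0⟩, hx1, hy1⟩ := hΔ (subset_convexHull ℝ _ hz)
    dsimp only at hx0 hy0 hx1 hy1
    norm_cast at hx0 hx1 hy0
    lift y to ℕ using hy0
    refine ⟨y, by exact_mod_cast hy1, ?_⟩
    obtain rfl | rfl : x = 0 ∨ x = 1 := by omega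
    · left; simp
    · right; simp
  have adjacent : ∀ {i j : ℕ}, ((i : ℝ) - j) ^ 2 = 1 → j = i + 1 ∨ i = j + 1 := by
    intro i j hij
    have : ((i : ℤ) - j) ^ 2 = 1 := by exact_mod_cast hij
    rcases sq_eq_sq_iff_eq_or_eq_neg.1 (this.trans (one_pow 2).symm) with h | h <;> omega
  have left : ∀ {i j k : ℕ}, i ≤ n → j ≤ n → k ≤ n → ((i : ℝ) - j) ^ 2 = 1 →
      ∃ a b c d : ℕ, IsStep a b c d ∧ c ≤ n ∧ d ≤ n ∧
        convexHull ℝ {(0, (i : ℝ)), (0, (j : ℝ)), (1, (k : ℝ))} = slab a b c d := by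
    intro i j k hi hj hk hij
    obtain rfl | rfl := adjacent hij
    · refine ⟨i, k, i + 1, k, .inl ⟨rfl, rfl⟩, hj, hk, ?_⟩
      push_cast
      rw [slab_left_eq, Set.pair_comm]
    · refine ⟨j, k, j + 1, k, .inl ⟨rfl, rfl⟩, hi, hk, ?_⟩
      push_cast
      rw [slab_left_eq, Set.insert_comm, Set.pair_comm]
  have right : ∀ {i j k : ℕ}, i ≤ n → j ≤ n → k ≤ n → ((i : ℝ) - j) ^ 2 = 1 →
      ∃ a b c d : ℕ, IsStep a b c d ∧ c ≤ n ∧ d ≤ n ∧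
        convexHull ℝ {(0, (k : ℝ)), (1, (i : ℝ)), (1, (j : ℝ))} = slab a b c d := by
    intro i j k hi hj hk hij
    obtain rfl | rfl := adjacent hij
    · refine ⟨k, i, k, i + 1, .inr ⟨rfl, rfl⟩, hk, hj, ?_⟩
      push_cast
      rw [slab_right_eq]
    · refine ⟨k, j, k, j + 1, .inr ⟨rfl, rfl⟩, hk, hi, ?_⟩
      push_cast
      rw [slab_right_eq, Set.pair_comm]
  have hsq : triDet p q r ^ 2 = 1 := by rw [← sq_abs, hdet, one_pow]
  obtain ⟨i, hi, hp⟩ := lattice p (by simp) hp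
  obtain ⟨j, hj, hq⟩ := lattice q (by simp) hq
  obtain ⟨k, hk, hr⟩ := lattice r (by simp) hr
  clear hdet lattice hΔ
  rcases hp with rfl | rfl <;> rcases hq with rfl | rfl <;> rcases hr with rfl | rfl <;>
    simp only [triDet] at hsq
  · norm_num at hsq
  · exact left hi hj hk (by linear_combination hsq)
  · rw [Set.pair_comm]
    exact left hi hk hj (by linear_combination hsq)
  · exact right hj hk hi (by linear_combination hsq)
  · rw [Set.insert_comm, Set.pair_comm]
    exact left hj hk hi (by linear_combination hsq)
  · rw [Set.insert_comm]
    exact right hi hk hj (by linear_combination hsq)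
  · rw [Set.pair_comm, Set.insert_comm]
    exact right hi hj hk (by linear_combination hsq)
  · norm_num at hsq

theorem IsStep.add_eq {a b c d : ℕ} (h : IsStep a b c d) : c + d = a + b + 1 := by
  rcases h with ⟨rfl, rfl⟩ | ⟨rfl, rfl⟩ <;> omega

theorem slab_subset_slab {a b c d a' b' c' d' : ℝ} (hac : a ≤ c) (hbd : b ≤ d)
    (h : slab a b c d ⊆ slab a' b' c' d') : a' ≤ a ∧ b' ≤ b ∧ c ≤ c' ∧ d ≤ d' :=
  ⟨(zero_mk_mem_slab.1 (h (zero_mk_mem_slab.2 ⟨le_rfl, hac⟩))).1,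
    (one_mk_mem_slab.1 (h (one_mk_mem_slab.2 ⟨le_rfl, hbd⟩))).1,
    (zero_mk_mem_slab.1 (h (zero_mk_mem_slab.2 ⟨hac, le_rfl⟩))).2,
    (one_mk_mem_slab.1 (h (one_mk_mem_slab.2 ⟨hbd, le_rfl⟩))).2⟩

theorem IsStep.le {a b c d : ℕ} (h : IsStep a b c d) : a ≤ c ∧ b ≤ d := by
  rcases h with ⟨rfl, rfl⟩ | ⟨rfl, rfl⟩ <;> omega

theorem IsStep.cast_le {a b c d : ℕ} (h : IsStep a b c d) : (a : ℝ) ≤ c ∧ (b : ℝ) ≤ d := by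
  exact_mod_cast h.le

theorem IsStep.slab_injective {a b c d a' b' c' d' : ℕ} (h : IsStep a b c d)
    (h' : IsStep a' b' c' d') (he : slab a b c d = slab a' b' c' d') :
    a = a' ∧ b = b' ∧ c = c' ∧ d = d' := by
  have h1 := slab_subset_slab h.cast_le.1 h.cast_le.2 he.subset
  have h2 := slab_subset_slab h'.cast_le.1 h'.cast_le.2 he.superset
  norm_cast at h1 h2
  omega

/-- An extreme subset of a slab which contains the midpoint of the segment from `(0, s)` to
`(1, t)` contains both its endpoints. -/
theorem IsExtreme.endpoints_mem {a b c d s t : ℝ} {F : Set (ℝ × ℝ)}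
    (hF : IsExtreme ℝ (slab a b c d) F) (hs : a ≤ s ∧ s ≤ c) (ht : b ≤ t ∧ t ≤ d)
    (hm : (1 / 2, (s + t) / 2) ∈ F) : (0, s) ∈ F ∧ (1, t) ∈ F := by
  have h0 : (0, s) ∈ slab a b c d := zero_mk_mem_slab.2 hs
  have h1 : (1, t) ∈ slab a b c d := one_mk_mem_slab.2 ht
  have : ((1 / 2, (s + t) / 2) : ℝ × ℝ) ∈ openSegment ℝ (0, s) (1, t) :=
    ⟨1 / 2, 1 / 2, by norm_num, by norm_num, by norm_num, by ext <;> simp; ring⟩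
  exact ⟨hF.2 h0 h1 hm this, hF.right_mem_of_mem_openSegment h0 h1 hm this⟩

/-- Two slabs over the same subinterval of the line `x = 1/2` which meet in a face coincide. -/
theorem IsStep.eq_of_isFaceOf {a b c d a' b' c' d' : ℕ} (h : IsStep a b c d)
    (h' : IsStep a' b' c' d') (hab : a + b = a' + b')
    (hF : IsFaceOf (slab a b c d ∩ slab a' b' c' d') (slab a b c d)) :
    a = a' ∧ b = b' ∧ c = c' ∧ d = d' := by
  obtain ⟨hac, hbd⟩ := h.cast_le
  have e := h.add_eq
  have e' := h'.add_eq
  have r : (c : ℝ) + d = a + b + 1 := by exact_mod_cast e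
  have r' : (c' : ℝ) + d' = a' + b' + 1 := by exact_mod_cast e'
  have rab : (a : ℝ) + b = a' + b' := by exact_mod_cast hab
  obtain ⟨⟨-, h1⟩, -, h2⟩ := hF.isExtreme.endpoints_mem (s := (a + c) / 2) (t := (b + d) / 2)
    ⟨by linarith, by linarith⟩ ⟨by linarith, by linarith⟩
    ⟨half_mk_mem_slab.2 ⟨by linarith, by linarith⟩, half_mk_mem_slab.2 ⟨by linarith, by linarith⟩⟩
  rw [zero_mk_mem_slab] at h1
  rw [one_mk_mem_slab] at h2
  have g1 : 2 * a' ≤ a + c := by have := h1.1; rify; linarith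
  have g2 : a + c ≤ 2 * c' := by have := h1.2; rify; linarith
  have g3 : 2 * b' ≤ b + d := by have := h2.1; rify; linarith
  have g4 : b + d ≤ 2 * d' := by have := h2.2; rify; linarith
  unfold IsStep at h h'
  omega

/-- If two slabs over consecutive subintervals of the line `x = 1/2` meet in a face, then the top
edge of the first one is the bottom edge of the second one. -/
theorem IsStep.consecutive_of_isFaceOf {a b c d a' b' c' d' : ℕ} (h : IsStep a b c d)
    (h' : IsStep a' b' c' d') (hab : c + d = a' + b')
    (hF : IsFaceOf (slab a b c d ∩ slab a' b' c' d') (slab a b c d)) :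
    c = a' ∧ d = b' := by
  obtain ⟨hac, hbd⟩ := h.cast_le
  obtain ⟨hac', hbd'⟩ := h'.cast_le
  have rab : (c : ℝ) + d = a' + b' := by exact_mod_cast hab
  obtain ⟨⟨-, h1⟩, -, h2⟩ := hF.isExtreme.endpoints_mem (s := c) (t := d) ⟨hac, le_rfl⟩
    ⟨hbd, le_rfl⟩
    ⟨half_mk_mem_slab.2 ⟨by linarith, by linarith⟩, half_mk_mem_slab.2 ⟨by linarith, by linarith⟩⟩
  have g1 : a' ≤ c := by exact_mod_cast (zero_mk_mem_slab.1 h1).1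
  have g2 : b' ≤ d := by exact_mod_cast (one_mk_mem_slab.1 h2).1
  omega

/-- The number of steps to the left before time `k` in the lattice path coded by `s`. -/
def leftHeight (s : Finset ℕ) (k : ℕ) : ℕ := ((Finset.range k).filter (· ∈ s)).card

/-- The number of steps to the right before time `k` in the lattice path coded by `s`. -/
def rightHeight (s : Finset ℕ) (k : ℕ) : ℕ := ((Finset.range k).filter (· ∉ s)).card

/-- The triangle corresponding to the `k`-th step of the lattice path coded by `s`. -/
def stepSlab (s : Finset ℕ) (k : ℕ) : Set (ℝ × ℝ) :=
  slab (leftHeight s k) (rightHeight s k) (leftHeight s (k + 1)) (rightHeight s (k + 1))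

/-- The triangulation corresponding to the lattice path of length `m` coded by `s`. -/
def pathTriangulation (m : ℕ) (s : Finset ℕ) : Set (Set (ℝ × ℝ)) :=
  stepSlab s '' {k | k < m}

theorem leftHeight_add_rightHeight (s : Finset ℕ) (k : ℕ) :
    leftHeight s k + rightHeight s k = k := by
  simpa [leftHeight, rightHeight] using
    Finset.card_filter_add_card_filter_not (s := Finset.range k) (· ∈ s)

theorem heights_succ (s : Finset ℕ) (k : ℕ) :
    (k ∈ s → leftHeight s (k + 1) = leftHeight s k + 1 ∧
      rightHeight s (k + 1) = rightHeight s k) ∧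
    (k ∉ s → leftHeight s (k + 1) = leftHeight s k ∧
      rightHeight s (k + 1) = rightHeight s k + 1) := by
  unfold leftHeight rightHeight
  constructor <;> intro h <;> simp [Finset.range_add_one, Finset.filter_insert, h]

theorem isStep_heights (s : Finset ℕ) (k : ℕ) :
    IsStep (leftHeight s k) (rightHeight s k) (leftHeight s (k + 1)) (rightHeight s (k + 1)) := by
  by_cases h : k ∈ s
  · exact .inl ((heights_succ s k).1 h)
  · exact .inr ((heights_succ s k).2 h)

theorem leftHeight_mono (s : Finset ℕ) : Monotone (leftHeight s) :=
  monotone_nat_of_le_succ fun k => (isStep_heights s k).le.1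

theorem rightHeight_mono (s : Finset ℕ) : Monotone (rightHeight s) :=
  monotone_nat_of_le_succ fun k => (isStep_heights s k).le.2

theorem leftHeight_eq_card {s : Finset ℕ} {m : ℕ} (hs : s ⊆ Finset.range m) :
    leftHeight s m = s.card := by
  unfold leftHeight
  congr 1
  ext x
  have := @hs x
  grind

theorem leftHeight_zero (s : Finset ℕ) : leftHeight s 0 = 0 := rfl

theorem rightHeight_zero (s : Finset ℕ) : rightHeight s 0 = 0 := rfl

theorem mem_iff_slab_mem_pathTriangulation {m k : ℕ} {s : Finset ℕ} (hk : k < m) :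
    k ∈ s ↔ ∃ a b : ℕ, a + b = k ∧ slab a b (a + 1 : ℕ) b ∈ pathTriangulation m s := by
  constructor
  · intro h
    refine ⟨leftHeight s k, rightHeight s k, leftHeight_add_rightHeight s k, k, hk, ?_⟩
    obtain ⟨h1, h2⟩ := (heights_succ s k).1 h
    rw [stepSlab, h1, h2]
  · rintro ⟨a, b, hab, j, -, hj⟩
    obtain ⟨h1, h2, h3, h4⟩ := (isStep_heights s j).slab_injective (.inl ⟨rfl, rfl⟩) hj
    have := leftHeight_add_rightHeight s j
    obtain rfl : j = k := by omega
    by_contra hmem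
    have := (heights_succ s j).2 hmem
    omega

theorem pathTriangulation_injOn (m : ℕ) :
    InjOn (pathTriangulation m) {s : Finset ℕ | s ⊆ Finset.range m} := by
  intro s hs t ht hst
  ext k
  by_cases hk : k < m
  · rw [mem_iff_slab_mem_pathTriangulation hk, hst, ← mem_iff_slab_mem_pathTriangulation hk]
  · have h1 := @hs k
    have h2 := @ht k
    grind

theorem slab_subset_Icc {a b c d n : ℝ} (ha : 0 ≤ a) (hb : 0 ≤ b) (hc : c ≤ n) (hd : d ≤ n) :
    slab a b c d ⊆ Icc (0, 0) (1, n) := by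
  rintro ⟨x, y⟩ ⟨h0, h1, h2, h3⟩
  dsimp only at h0 h1 h2 h3
  exact ⟨⟨h0, by nlinarith⟩, h1, by dsimp only; nlinarith⟩

theorem isUnimodularTriangulation_pathTriangulation {n : ℕ} (hn : 1 ≤ n) {s : Finset ℕ}
    (hs : s ⊆ Finset.range (2 * n)) (hcard : s.card = n) :
    IsUnimodularTriangulation (Icc (0, 0) (1, (n : ℝ))) (pathTriangulation (2 * n) s) := by
  have hl : leftHeight s (2 * n) = n := by rw [leftHeight_eq_card hs, hcard]
  have hr : rightHeight s (2 * n) = n := by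
    have := leftHeight_add_rightHeight s (2 * n)
    omega
  have hsub : ∀ k < 2 * n, stepSlab s k ⊆ Icc (0, 0) (1, (n : ℝ)) := by
    intro k hk
    refine slab_subset_Icc (by positivity) (by positivity) ?_ ?_
    · exact_mod_cast hl ▸ leftHeight_mono s (show k + 1 ≤ 2 * n from hk)
    · exact_mod_cast hr ▸ rightHeight_mono s (show k + 1 ≤ 2 * n from hk)
  have hface : ∀ j k, j < k →
      IsFaceOf (stepSlab s j ∩ stepSlab s k) (stepSlab s j) ∧
        IsFaceOf (stepSlab s j ∩ stepSlab s k) (stepSlab s k) := by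
    intro j k hjk
    obtain ⟨h1, h2⟩ := (isStep_heights s j).cast_le
    obtain ⟨h3, h4⟩ := (isStep_heights s k).cast_le
    have := slab_inter_slab (c := leftHeight s (j + 1)) (a' := leftHeight s k)
      (d := rightHeight s (j + 1)) (b' := rightHeight s k)
      (by exact_mod_cast leftHeight_mono s hjk) (by exact_mod_cast rightHeight_mono s hjk)
      h1 h2 h3 h4
    exact ⟨(isStep_heights s j).isFaceOf (.inr (.inl this.1)),
      (isStep_heights s k).isFaceOf (.inl this.2)⟩
  refine ⟨(Set.finite_lt_nat _).image _, ?_, Subset.antisymm ?_ ?_, ?_⟩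
  · rintro _ ⟨k, hk, rfl⟩
    exact ⟨(isStep_heights s k).isUnimodularTriangle, hsub k hk⟩
  · rintro p ⟨_, ⟨k, hk, rfl⟩, hp⟩
    exact hsub k hk hp
  · rintro ⟨x, y⟩ ⟨⟨hx0, hy0⟩, hx1, hy1⟩
    dsimp only at hx0 hy0 hx1 hy1
    have below : ∀ m : ℕ, y ≤ (1 - x) * leftHeight s (m + 1) + x * rightHeight s (m + 1) →
        ∃ k ≤ m, (x, y) ∈ stepSlab s k := by
      intro m
      induction m with
      | zero =>
        intro hy
        exact ⟨0, le_rfl, hx0, hx1, by simpa [leftHeight_zero, rightHeight_zero] using hy0, hy⟩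
      | succ m ih =>
        intro hy
        by_cases hm : y ≤ (1 - x) * leftHeight s (m + 1) + x * rightHeight s (m + 1)
        · obtain ⟨k, hk, hmem⟩ := ih hm
          exact ⟨k, by omega, hmem⟩
        · exact ⟨m + 1, le_rfl, hx0, hx1, (not_le.1 hm).le, hy⟩
    obtain ⟨k, hk, hmem⟩ := below (2 * n - 1) (by
      rw [show 2 * n - 1 + 1 = 2 * n by omega, hl, hr]
      linarith)
    exact ⟨_, ⟨k, by simp only [mem_ofPred_eq]; omega, rfl⟩, hmem⟩
  · rintro _ ⟨j, -, rfl⟩ _ ⟨k, -, rfl⟩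
    rcases lt_trichotomy j k with hjk | rfl | hjk
    · exact hface j k hjk
    · rw [inter_self]
      exact ⟨(isStep_heights s j).isFaceOf (.inr (.inr rfl)),
        (isStep_heights s j).isFaceOf (.inr (.inr rfl))⟩
    · rw [inter_comm]
      exact (hface k j hjk).symm

theorem IsUnimodularTriangulation.exists_pathTriangulation_eq {n : ℕ} (hn : 1 ≤ n)
    {T : Set (Set (ℝ × ℝ))}
    (hT : IsUnimodularTriangulation (Icc (0, 0) (1, (n : ℝ))) T) :
    ∃ s ⊆ Finset.range (2 * n), s.card = n ∧ pathTriangulation (2 * n) s = T := by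
  obtain ⟨-, htri, hunion, hface⟩ := hT
  have exists_slab : ∀ k < 2 * n, ∃ a b c d : ℕ, a + b = k ∧ IsStep a b c d ∧
      slab a b c d ∈ T := by
    intro k hk
    have hk' : (k : ℝ) + 1 ≤ 2 * n := by exact_mod_cast hk
    have hmem : ((1 / 2, (k + 1 / 2) / 2) : ℝ × ℝ) ∈ ⋃₀ T := by
      rw [hunion]
      refine ⟨⟨by norm_num, by positivity⟩, by norm_num, ?_⟩
      dsimp only
      linarith
    obtain ⟨Δ, hΔ, hz⟩ := hmem
    obtain ⟨a, b, c, d, hstep, -, -, rfl⟩ := exists_eq_slab (htri Δ hΔ).1 (htri Δ hΔ).2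
    refine ⟨a, b, c, d, ?_, hstep, hΔ⟩
    obtain ⟨h1, h2⟩ := half_mk_mem_slab.1 hz
    have e : (c : ℝ) + d = a + b + 1 := by exact_mod_cast hstep.add_eq
    have g1 : a + b < k + 1 := by rify; linarith
    have g2 : k < a + b + 1 := by rify; linarith
    omega
  classical
  set s : Finset ℕ := (Finset.range (2 * n)).filter
    fun k => ∃ a b : ℕ, a + b = k ∧ slab a b (a + 1 : ℕ) b ∈ T
  have hmem : ∀ {a b c d : ℕ}, IsStep a b c d → slab a b c d ∈ T → a + b < 2 * n →
      a = leftHeight s (a + b) → b = rightHeight s (a + b) →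
      c = leftHeight s (a + b + 1) ∧ d = rightHeight s (a + b + 1) := by
    intro a b c d hstep hΔ hlt ha hb
    by_cases h : a + b ∈ s
    · obtain ⟨h1, h2⟩ := (heights_succ s (a + b)).1 h
      obtain ⟨-, a', b', hab, hΔ'⟩ := Finset.mem_filter.1 h
      have := hstep.eq_of_isFaceOf (.inl ⟨rfl, rfl⟩) hab.symm (hface _ hΔ _ hΔ').1
      omega
    · obtain ⟨h1, h2⟩ := (heights_succ s (a + b)).2 h
      rcases hstep with ⟨rfl, rfl⟩ | ⟨rfl, rfl⟩
      · exact (h (Finset.mem_filter.2 ⟨Finset.mem_range.2 hlt, a, d, rfl, hΔ⟩)).elim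
      · omega
  have hstepSlab : ∀ k < 2 * n, stepSlab s k ∈ T := by
    intro k
    induction k with
    | zero =>
      intro hk
      obtain ⟨a, b, c, d, hab, hstep, hΔ⟩ := exists_slab 0 hk
      obtain ⟨rfl, rfl⟩ : a = 0 ∧ b = 0 := by omega
      obtain ⟨rfl, rfl⟩ := hmem hstep hΔ hk rfl rfl
      exact hΔ
    | succ k ih =>
      intro hk
      obtain ⟨a, b, c, d, hab, hstep, hΔ⟩ := exists_slab (k + 1) hk
      have := leftHeight_add_rightHeight s (k + 1)
      obtain ⟨h1, h2⟩ := (isStep_heights s k).consecutive_of_isFaceOf hstep (by omega)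
        (hface _ (ih (by omega)) _ hΔ).1
      obtain ⟨h3, h4⟩ := hmem hstep hΔ (by omega) (by rw [hab, h1]) (by rw [hab, h2])
      rw [hab] at h3 h4
      rw [stepSlab, h1, h2, ← h3, ← h4]
      exact hΔ
  have hsub : s ⊆ Finset.range (2 * n) := Finset.filter_subset _ _
  refine ⟨s, hsub, ?_, Subset.antisymm ?_ ?_⟩
  · have hlast := hstepSlab (2 * n - 1) (by omega)
    obtain ⟨a, b, c, d, hstep, hc, hd, he⟩ :=
      exists_eq_slab (htri _ hlast).1 (htri _ hlast).2
    have h1 := (isStep_heights s (2 * n - 1)).slab_injective hstep he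
    have h2 := leftHeight_add_rightHeight s (2 * n)
    have h3 := leftHeight_eq_card hsub
    rw [show 2 * n - 1 + 1 = 2 * n by omega] at h1
    omega
  · rintro _ ⟨k, hk, rfl⟩
    exact hstepSlab k hk
  · intro Δ hΔ
    obtain ⟨a, b, c, d, hstep, hc, hd, rfl⟩ := exists_eq_slab (htri Δ hΔ).1 (htri Δ hΔ).2
    have hlt : a + b < 2 * n := by
      have := hstep.add_eq
      omega
    refine ⟨a + b, hlt, ?_⟩
    obtain ⟨h1, h2, h3, h4⟩ := (isStep_heights s (a + b)).eq_of_isFaceOf hstep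
      (leftHeight_add_rightHeight s (a + b)) (hface _ (hstepSlab _ hlt) _ hΔ).1
    rw [stepSlab, h1, h2, h3, h4]

/-- For every integer `n ≥ 1`, the number of unimodular triangulations of the
rectangle `[0,1] × [0,n]` equals the central binomial coefficient `C(2n,n)`. -/
theorem f_one_n (n : ℕ) (hn : 1 ≤ n) : f 1 n = Nat.choose (2 * n) n := by
  have key : {T | IsUnimodularTriangulation (Icc (0, 0) (1, (n : ℝ))) T} =
      pathTriangulation (2 * n) '' (Finset.powersetCard n (Finset.range (2 * n))) := by
    ext T
    simp only [mem_ofPred_eq, mem_image, Finset.mem_coe, Finset.mem_powersetCard, and_assoc]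
    constructor
    · exact fun hT => hT.exists_pathTriangulation_eq hn
    · rintro ⟨s, hs, hcard, rfl⟩
      exact isUnimodularTriangulation_pathTriangulation hn hs hcard
  rw [f, numTriangulations, Nat.cast_one, key, InjOn.ncard_image, Set.ncard_coe_finset,
    Finset.card_powersetCard, Finset.card_range]
  exact (pathTriangulation_injOn (2 * n)).mono fun s hs =>
    (Finset.mem_powersetCard.1 (Finset.mem_coe.1 hs)).1
end
end

section
/- For every integer n ≥ 1, f(2,n) = C(2n,n)² + 2·Σ g₂(A,B)·C(2n − (3A+B+1)/2, n−A)·C(2n − (A+3B+1)/2, n−B), where the sum ranges over all integers A, B with 0 ≤ A < B ≤ n and A + B ≡ 1 (mod 2). -/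
open Set

noncomputable section

/-- `g₂ A B` is the number of unimodular triangulations of the width-2 trapezoid
`conv{(0,0), (2,0), (0,A), (2,B)}`. -/
def g₂ (A B : ℕ) : ℕ :=
  numTriangulations
    (convexHull ℝ {((0 : ℝ), (0 : ℝ)), (2, 0), (0, (A : ℝ)), (2, (B : ℝ))})

open MeasureTheory

/-- The convex hull of a positively oriented triangle of determinant `1` in terms of
barycentric coordinates. -/
lemma convexHull_eq_triDet {p q r : ℝ × ℝ} (h : triDet p q r = 1) :
    convexHull ℝ {p, q, r} =
      {z | 0 ≤ triDet p q z ∧ 0 ≤ triDet q r z ∧ 0 ≤ triDet r p z} := by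
  obtain ⟨p1, p2⟩ := p
  obtain ⟨q1, q2⟩ := q
  obtain ⟨r1, r2⟩ := r
  simp only [triDet] at h ⊢
  apply Set.Subset.antisymm
  · apply convexHull_min
    · rintro z (rfl | rfl | rfl) <;> refine ⟨?_, ?_, ?_⟩ <;> dsimp only <;> nlinarith
    · rintro ⟨x, y⟩ ⟨h1, h2, h3⟩ ⟨x', y'⟩ ⟨h1', h2', h3'⟩ a b ha hb hab
      obtain rfl : a = 1 - b := by linarith
      simp only [Set.mem_ofPred_eq, Prod.smul_mk, Prod.mk_add_mk, smul_eq_mul] at *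
      refine ⟨?_, ?_, ?_⟩
      · linear_combination (1 - b) * h1 + b * h1'
      · linear_combination (1 - b) * h2 + b * h2'
      · linear_combination (1 - b) * h3 + b * h3'
  · rintro ⟨x, y⟩ ⟨h1, h2, h3⟩
    dsimp only at *
    have hc := (convex_convexHull ℝ {((p1, p2) : ℝ × ℝ), (q1, q2), (r1, r2)})
    have := hc.sum_mem (t := Finset.univ)
      (w := ![(r1 - q1) * (y - q2) - (r2 - q2) * (x - q1),
        (p1 - r1) * (y - r2) - (p2 - r2) * (x - r1),
        (q1 - p1) * (y - p2) - (q2 - p2) * (x - p1)])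
      (z := ![((p1, p2) : ℝ × ℝ), (q1, q2), (r1, r2)])
      (by intro i _; fin_cases i <;> simp <;> linarith)
      (by simp [Fin.sum_univ_three]; linear_combination h)
      (by intro i _; fin_cases i <;> apply subset_convexHull <;> simp)
    convert this using 1
    simp only [Fin.sum_univ_three, Matrix.cons_val_zero, Matrix.cons_val_one, Matrix.cons_val_two,
      Matrix.head_cons, Matrix.tail_cons, Prod.smul_mk, Prod.mk_add_mk, smul_eq_mul]
    ext
    · dsimp only; linear_combination (-x) * h
    · dsimp only; linear_combination (-y) * h

lemma affineIndependent_of_triDet_ne_zero {p q r : ℝ × ℝ} (h : triDet p q r ≠ 0) :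
    AffineIndependent ℝ ![p, q, r] := by
  rw [affineIndependent_iff_not_collinear_set]
  intro hc
  rw [collinear_iff_of_mem (p₀ := p) (by simp)] at hc
  obtain ⟨v, hv⟩ := hc
  obtain ⟨a, ha⟩ := hv q (by simp)
  obtain ⟨b, hb⟩ := hv r (by simp)
  apply h
  subst ha hb
  simp [triDet]
  ring

/-- An explicit positively oriented unimodular lattice triangle. -/
lemma isUnimodularTriangle_iff {Δ : Set (ℝ × ℝ)} :
    IsUnimodularTriangle Δ ↔ ∃ p q r : ℝ × ℝ, IsLatticePoint p ∧ IsLatticePoint q ∧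
      IsLatticePoint r ∧ triDet p q r = 1 ∧ Δ = convexHull ℝ {p, q, r} := by
  constructor
  · rintro ⟨p, q, r, hp, hq, hr, -, rfl, h⟩
    rcases eq_or_eq_neg_of_abs_eq h with h | h
    · exact ⟨p, q, r, hp, hq, hr, h, rfl⟩
    · refine ⟨p, r, q, hp, hr, hq, ?_, ?_⟩
      · simp only [triDet] at *; linarith
      · rw [Set.pair_comm]
  · rintro ⟨p, q, r, hp, hq, hr, h, rfl⟩
    exact ⟨p, q, r, hp, hq, hr, affineIndependent_of_triDet_ne_zero (by rw [h]; simp), rfl,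
      by rw [h]; simp⟩

/-- Points with positive barycentric coordinates are interior points. -/
lemma mem_interior_of_triDet_pos {p q r z : ℝ × ℝ} (h : triDet p q r = 1)
    (h1 : 0 < triDet p q z) (h2 : 0 < triDet q r z) (h3 : 0 < triDet r p z) :
    z ∈ interior (convexHull ℝ {p, q, r}) := by
  rw [mem_interior]
  refine ⟨{z | 0 < triDet p q z ∧ 0 < triDet q r z ∧ 0 < triDet r p z}, ?_, ?_, h1, h2, h3⟩
  · rw [convexHull_eq_triDet h]
    rintro z ⟨h1, h2, h3⟩
    exact ⟨h1.le, h2.le, h3.le⟩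
  · have hc : ∀ p q : ℝ × ℝ, Continuous (triDet p q) := by
      intro p q; unfold triDet; fun_prop
    exact (isOpen_lt continuous_const (hc _ _)).inter
      ((isOpen_lt continuous_const (hc _ _)).inter (isOpen_lt continuous_const (hc _ _)))

namespace IsUnimodularTriangle

variable {Δ : Set (ℝ × ℝ)}

lemma convex (h : IsUnimodularTriangle Δ) : Convex ℝ Δ := by
  obtain ⟨p, q, r, -, -, -, -, rfl⟩ := isUnimodularTriangle_iff.1 h
  exact convex_convexHull _ _

lemma isClosed (h : IsUnimodularTriangle Δ) : IsClosed Δ := by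
  obtain ⟨p, q, r, -, -, -, -, rfl⟩ := isUnimodularTriangle_iff.1 h
  exact (Set.Finite.isCompact_convexHull (𝕜 := ℝ) (Set.toFinite {p, q, r})).isClosed

lemma interior_nonempty (h : IsUnimodularTriangle Δ) : (interior Δ).Nonempty := by
  obtain ⟨p, q, r, -, -, -, hd, rfl⟩ := isUnimodularTriangle_iff.1 h
  clear h
  refine ⟨((p.1 + q.1 + r.1) / 3, (p.2 + q.2 + r.2) / 3), mem_interior_of_triDet_pos hd ?_ ?_ ?_⟩ <;>
  simp only [triDet] at * <;> linarith

lemma subset_closure_interior (h : IsUnimodularTriangle Δ) : Δ ⊆ closure (interior Δ) := by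
  rw [h.convex.closure_interior_eq_closure_of_nonempty_interior h.interior_nonempty]
  exact subset_closure

lemma volume_pos (h : IsUnimodularTriangle Δ) : 0 < volume Δ :=
  Measure.measure_pos_of_nonempty_interior _ h.interior_nonempty

lemma subset_of_interior_subset (h : IsUnimodularTriangle Δ) {C : Set (ℝ × ℝ)} (hC : IsClosed C)
    (hi : interior Δ ⊆ C) : Δ ⊆ C :=
  h.subset_closure_interior.trans (closure_minimal hi hC)

end IsUnimodularTriangle

/-- Lines are null sets. -/
lemma volume_line {a b c : ℝ} (h : a ≠ 0 ∨ b ≠ 0) :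
    volume {z : ℝ × ℝ | a * z.1 + b * z.2 = c} = 0 := by
  let L : ℝ × ℝ →ₗ[ℝ] ℝ := a • LinearMap.fst ℝ ℝ ℝ + b • LinearMap.snd ℝ ℝ ℝ
  have hL : ∀ z, L z = a * z.1 + b * z.2 := fun z => by simp [L]
  by_cases hex : ∃ z0, L z0 = c
  · obtain ⟨z0, hz0⟩ := hex
    have := Measure.addHaar_affineSubspace volume (AffineSubspace.mk' z0 (LinearMap.ker L)) (by
      intro htop
      have h1 : ((1 : ℝ), (0 : ℝ)) + z0 ∈ AffineSubspace.mk' z0 (LinearMap.ker L) := by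
        rw [htop]; trivial
      have h2 : ((0 : ℝ), (1 : ℝ)) + z0 ∈ AffineSubspace.mk' z0 (LinearMap.ker L) := by
        rw [htop]; trivial
      rw [AffineSubspace.mem_mk'] at h1 h2
      simp [L] at h1 h2
      tauto)
    convert this using 2
    ext z
    simp only [Set.mem_ofPred_eq, SetLike.mem_coe, AffineSubspace.mem_mk', LinearMap.mem_ker,
      vsub_eq_sub]
    rw [map_sub, hz0, hL, sub_eq_zero]
  · convert measure_empty (μ := (volume : Measure (ℝ × ℝ)))
    ext z
    simp only [Set.mem_ofPred_eq, Set.mem_empty_iff_false, iff_false]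
    intro hz
    exact hex ⟨z, by rw [hL, hz]⟩

lemma mem_convexHull_triple_s2 {p q r z : ℝ × ℝ} (hz : z ∈ convexHull ℝ {p, q, r}) :
    ∃ a b c : ℝ, 0 ≤ a ∧ 0 ≤ b ∧ 0 ≤ c ∧ a + b + c = 1 ∧ a • p + b • q + c • r = z := by
  rw [convexHull_insert (by simp), convexHull_pair, mem_convexJoin] at hz
  obtain ⟨x, hx, y, ⟨b, c, hb, hc, hbc, rfl⟩, ⟨a, d, ha, hd, had, rfl⟩⟩ := hz
  rw [Set.mem_singleton_iff] at hx
  subst hx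
  refine ⟨a, d * b, d * c, ha, mul_nonneg hd hb, mul_nonneg hd hc, ?_, ?_⟩
  · linear_combination had + d * hbc
  · rw [smul_add, smul_smul, smul_smul, add_assoc]

section Faces

variable {p q r : ℝ × ℝ} {φ : ℝ × ℝ →L[ℝ] ℝ} {u : ℝ}

lemma convexHull_inter_level_eq_empty (hp : φ p < u) (hq : φ q < u) (hr : φ r < u) :
    convexHull ℝ {p, q, r} ∩ {z | φ z = u} = ∅ := by
  rw [Set.eq_empty_iff_forall_notMem]
  rintro z ⟨hz, hu : φ z = u⟩
  obtain ⟨a, b, c, ha, hb, hc, h1, rfl⟩ := mem_convexHull_triple_s2 hz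
  simp only [map_add, map_smul, smul_eq_mul] at hu
  have h0 : a * (u - φ p) + b * (u - φ q) + c * (u - φ r) = 0 := by
    linear_combination u * h1 - hu
  have e1 := mul_nonneg ha (sub_nonneg.2 hp.le)
  have e2 := mul_nonneg hb (sub_nonneg.2 hq.le)
  have e3 := mul_nonneg hc (sub_nonneg.2 hr.le)
  have f1 : a * (u - φ p) = 0 := by linarith
  have f2 : b * (u - φ q) = 0 := by linarith
  have f3 : c * (u - φ r) = 0 := by linarith
  rw [mul_eq_zero, or_iff_left (by linarith)] at f1 f2 f3
  linarith

lemma convexHull_inter_level_eq_singleton (hp : φ p = u) (hq : φ q < u) (hr : φ r < u) :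
    convexHull ℝ {p, q, r} ∩ {z | φ z = u} = {p} := by
  apply Set.Subset.antisymm
  · rintro z ⟨hz, hu : φ z = u⟩
    obtain ⟨a, b, c, ha, hb, hc, h1, rfl⟩ := mem_convexHull_triple_s2 hz
    simp only [map_add, map_smul, smul_eq_mul, hp] at hu
    have h0 : b * (u - φ q) + c * (u - φ r) = 0 := by
      linear_combination u * h1 - hu
    have e2 := mul_nonneg hb (sub_nonneg.2 hq.le)
    have e3 := mul_nonneg hc (sub_nonneg.2 hr.le)
    have f2 : b * (u - φ q) = 0 := by linarith
    have f3 : c * (u - φ r) = 0 := by linarith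
    rw [mul_eq_zero, or_iff_left (by linarith)] at f2 f3
    subst f2 f3
    obtain rfl : a = 1 := by linarith
    simp
  · rintro z rfl
    exact ⟨subset_convexHull _ _ (by simp), hp⟩

lemma convexHull_inter_level_eq_segment (hp : φ p = u) (hq : φ q = u) (hr : φ r < u) :
    convexHull ℝ {p, q, r} ∩ {z | φ z = u} = segment ℝ p q := by
  apply Set.Subset.antisymm
  · rintro z ⟨hz, hu : φ z = u⟩
    obtain ⟨a, b, c, ha, hb, hc, h1, rfl⟩ := mem_convexHull_triple_s2 hz
    simp only [map_add, map_smul, smul_eq_mul, hp, hq] at hu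
    have f3 : c * (u - φ r) = 0 := by
      linear_combination u * h1 - hu
    rw [mul_eq_zero, or_iff_left (by linarith)] at f3
    subst f3
    exact ⟨a, b, ha, hb, by linarith, by simp⟩
  · rintro z ⟨a, b, ha, hb, hab, rfl⟩
    refine ⟨?_, ?_⟩
    · exact (convex_convexHull ℝ _) (subset_convexHull _ _ (by simp))
        (subset_convexHull _ _ (by simp)) ha hb hab
    · simp only [Set.mem_ofPred_eq, map_add, map_smul, smul_eq_mul, hp, hq]
      rw [← add_mul, hab, one_mul]

/-- `(p, q, r)` are the vertices of `Δ`, ordered such that the face on which `φ = u` is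
empty, the vertex `p`, or the edge `pq`. -/
def FaceAdapted (φ : ℝ × ℝ →L[ℝ] ℝ) (u : ℝ) (Δ : Set (ℝ × ℝ)) (p q r : ℝ × ℝ) : Prop :=
  IsLatticePoint p ∧ IsLatticePoint q ∧ IsLatticePoint r ∧ |triDet p q r| = 1 ∧
    Δ = convexHull ℝ {p, q, r} ∧
    (Δ ∩ {z | φ z = u} = ∅ ∨ (φ p = u ∧ Δ ∩ {z | φ z = u} = {p}) ∨
      (φ p = u ∧ φ q = u ∧ Δ ∩ {z | φ z = u} = segment ℝ p q))

lemma IsUnimodularTriangle.exists_faceAdapted {Δ : Set (ℝ × ℝ)} (h : IsUnimodularTriangle Δ)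
    (hle : ∀ z ∈ Δ, φ z ≤ u) (hlt : ∃ z ∈ Δ, φ z < u) : ∃ p q r, FaceAdapted φ u Δ p q r := by
  obtain ⟨p, q, r, lp, lq, lr, -, rfl, hd⟩ := h
  have hp := hle p (subset_convexHull _ _ (by simp))
  have hq := hle q (subset_convexHull _ _ (by simp))
  have hr := hle r (subset_convexHull _ _ (by simp))
  have d1 : |triDet q p r| = 1 := by
    rw [← hd, ← abs_neg]; congr 1; simp only [triDet]; ring
  have d2 : |triDet q r p| = 1 := by
    rw [← hd]; congr 1; simp only [triDet]; ring
  have d3 : |triDet r p q| = 1 := by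
    rw [← hd]; congr 1; simp only [triDet]; ring
  have d4 : |triDet p r q| = 1 := by
    rw [← hd, ← abs_neg]; congr 1; simp only [triDet]; ring
  have s1 : ({p, q, r} : Set (ℝ × ℝ)) = {q, r, p} := by
    rw [Set.insert_comm, Set.pair_comm]
  have s2 : ({p, q, r} : Set (ℝ × ℝ)) = {r, p, q} := by
    rw [Set.pair_comm, Set.insert_comm]
  have s3 : ({p, q, r} : Set (ℝ × ℝ)) = {p, r, q} := by
    rw [Set.pair_comm]
  rcases hp.lt_or_eq with hp | hp <;> rcases hq.lt_or_eq with hq | hq <;>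
    rcases hr.lt_or_eq with hr | hr
  · exact ⟨p, q, r, lp, lq, lr, hd, rfl, Or.inl (convexHull_inter_level_eq_empty hp hq hr)⟩
  · exact ⟨r, p, q, lr, lp, lq, d3, by rw [s2], Or.inr (Or.inl ⟨hr, by
      rw [s2]; exact convexHull_inter_level_eq_singleton hr hp hq⟩)⟩
  · exact ⟨q, r, p, lq, lr, lp, d2, by rw [s1], Or.inr (Or.inl ⟨hq, by
      rw [s1]; exact convexHull_inter_level_eq_singleton hq hr hp⟩)⟩
  · exact ⟨q, r, p, lq, lr, lp, d2, by rw [s1], Or.inr (Or.inr ⟨hq, hr, by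
      rw [s1]; exact convexHull_inter_level_eq_segment hq hr hp⟩)⟩
  · exact ⟨p, q, r, lp, lq, lr, hd, rfl, Or.inr (Or.inl ⟨hp,
      convexHull_inter_level_eq_singleton hp hq hr⟩)⟩
  · exact ⟨p, r, q, lp, lr, lq, d4, by rw [s3], Or.inr (Or.inr ⟨hp, hr, by
      rw [s3]; exact convexHull_inter_level_eq_segment hp hr hq⟩)⟩
  · exact ⟨p, q, r, lp, lq, lr, hd, rfl, Or.inr (Or.inr ⟨hp, hq,
      convexHull_inter_level_eq_segment hp hq hr⟩)⟩
  · exfalso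
    obtain ⟨z, hz, hu⟩ := hlt
    obtain ⟨a, b, c, ha, hb, hc, h1, rfl⟩ := mem_convexHull_triple_s2 hz
    simp only [map_add, map_smul, smul_eq_mul, hp, hq, hr] at hu
    rw [← add_mul, ← add_mul, h1, one_mul] at hu
    exact lt_irrefl _ hu

lemma IsLatticePoint.triDet_eq_intCast (hp : IsLatticePoint p) (hq : IsLatticePoint q)
    (hr : IsLatticePoint r) : ∃ k : ℤ, triDet p q r = k := by
  obtain ⟨a, b, rfl⟩ := hp
  obtain ⟨c, d, rfl⟩ := hq
  obtain ⟨e, g, rfl⟩ := hr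
  exact ⟨(c - a) * (g - b) - (d - b) * (e - a), by simp [triDet]⟩

/-- Lattice points on the line through the edge `pq` of a unimodular triangle `pqr`. -/
lemma exists_int_of_level (lp : IsLatticePoint p) (lr : IsLatticePoint r)
    (hd : |triDet p q r| = 1) (hφ : φ ≠ 0) (hp : φ p = u) (hq : φ q = u) {x : ℝ × ℝ}
    (lx : IsLatticePoint x) (hx : φ x = u) : ∃ k : ℤ, x = p + (k : ℝ) • (q - p) := by
  obtain ⟨m, hm⟩ := lp.triDet_eq_intCast lx lr
  have hexp : ∀ z : ℝ × ℝ, φ z = z.1 * φ (1, 0) + z.2 * φ (0, 1) := by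
    intro z
    conv_lhs => rw [show z = z.1 • ((1 : ℝ), (0 : ℝ)) + z.2 • ((0 : ℝ), (1 : ℝ)) by
      ext <;> simp]
    rw [map_add, map_smul, map_smul, smul_eq_mul, smul_eq_mul]
  set a := φ (1, 0)
  set b := φ (0, 1)
  have hab : a ≠ 0 ∨ b ≠ 0 := by
    by_contra! h
    apply hφ
    ext
    · simp [hexp, h.1, h.2]
    · simp [hexp, h.1, h.2]
  have h0 : triDet p q x = 0 := by
    have e1 : (q.1 - p.1) * a + (q.2 - p.2) * b = 0 := by
      rw [hexp] at hp hq; linarith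
    have e2 : (x.1 - p.1) * a + (x.2 - p.2) * b = 0 := by
      rw [hexp] at hp hx; linarith
    unfold triDet
    rcases hab with h | h <;> apply mul_left_cancel₀ h
    · linear_combination (x.2 - p.2) * e1 - (q.2 - p.2) * e2
    · linear_combination (q.1 - p.1) * e2 - (x.1 - p.1) * e1
  obtain ⟨ε, hε, hε2⟩ : ∃ ε : ℤ, (ε : ℝ) = triDet p q r ∧ (ε : ℝ) * ε = 1 := by
    rcases eq_or_eq_neg_of_abs_eq hd with h | h
    · exact ⟨1, by simp [h], by simp⟩
    · exact ⟨-1, by simp [h], by simp⟩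
  refine ⟨ε * m, ?_⟩
  push_cast
  rw [← hm]
  simp only [triDet] at *
  ext
  · simp only [Prod.fst_add, Prod.smul_fst, Prod.fst_sub, smul_eq_mul]
    linear_combination (-(x.1 - p.1)) * hε2 + (ε : ℝ) * (x.1 - p.1) * hε
      - (ε : ℝ) * (p.1 - r.1) * h0
  · simp only [Prod.snd_add, Prod.smul_snd, Prod.snd_sub, smul_eq_mul]
    linear_combination (-(x.2 - p.2)) * hε2 + (ε : ℝ) * (x.2 - p.2) * hε
      - (ε : ℝ) * (p.2 - r.2) * h0

lemma ne_of_abs_triDet_eq_one (hd : |triDet p q r| = 1) : q - p ≠ 0 := by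
  intro h
  rw [sub_eq_zero] at h
  subst h
  simp [triDet] at hd

/-- The intersection of a primitive lattice segment with a lattice segment one step long on the
same line. -/
lemma segment_inter_shift (v : ℝ × ℝ) (hv : v ≠ 0) (hq : q = p + v) (k : ℤ) :
    let F := segment ℝ p q ∩ segment ℝ (p + (k : ℝ) • v) (p + ((k : ℝ) + 1) • v)
    F = ∅ ∨ F = {p} ∨ F = {q} ∨ F = segment ℝ p q := by
  intro F
  subst hq
  have hF : ∀ z ∈ F, ∃ t s : ℝ, 0 ≤ t ∧ t ≤ 1 ∧ 0 ≤ s ∧ s ≤ 1 ∧ t = k + s ∧ z = p + t • v := by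
    rintro z ⟨h1, h2⟩
    rw [segment_eq_image'] at h1 h2
    obtain ⟨t, ⟨ht0, ht1⟩, rfl⟩ := h1
    obtain ⟨s, ⟨hs0, hs1⟩, hs⟩ := h2
    refine ⟨t, s, ht0, ht1, hs0, hs1, ?_, by simp⟩
    have : (t - (k + s)) • v = 0 := by
      dsimp only at hs
      have e : (p + (k : ℝ) • v + s • (p + ((k : ℝ) + 1) • v - (p + (k : ℝ) • v)))
        = p + (k + s) • v := by module
      have e2 : p + t • (p + v - p) = p + t • v := by module
      rw [e, e2] at hs
      have := add_left_cancel hs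
      rw [sub_smul, this, sub_self]
    rcases smul_eq_zero.1 this with h | h
    · linarith
    · exact absurd h hv
  rcases lt_trichotomy k 0 with hk | rfl | hk
  · by_cases hF0 : F = ∅
    · exact Or.inl hF0
    refine Or.inr (Or.inl ?_)
    refine (Set.nonempty_iff_ne_empty.2 hF0).subset_singleton_iff.1 ?_
    intro z hz
    obtain ⟨t, s, ht0, ht1, hs0, hs1, hts, rfl⟩ := hF z hz
    have : (k : ℝ) ≤ -1 := by exact_mod_cast (show k ≤ -1 by omega)
    obtain rfl : t = 0 := by linarith
    simp
  · refine Or.inr (Or.inr (Or.inr ?_))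
    simp [F]
  · by_cases hF0 : F = ∅
    · exact Or.inl hF0
    refine Or.inr (Or.inr (Or.inl ?_))
    refine (Set.nonempty_iff_ne_empty.2 hF0).subset_singleton_iff.1 ?_
    intro z hz
    obtain ⟨t, s, ht0, ht1, hs0, hs1, hts, rfl⟩ := hF z hz
    have : (1 : ℝ) ≤ k := by exact_mod_cast (show 1 ≤ k by omega)
    obtain rfl : t = 1 := by linarith
    simp

lemma isLatticePoint_mem_segment (lp : IsLatticePoint p) (lr : IsLatticePoint r)
    (hd : |triDet p q r| = 1) (hφ : φ ≠ 0) (hp : φ p = u) (hq : φ q = u) {x : ℝ × ℝ}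
    (lx : IsLatticePoint x) (hx : φ x = u) (hxs : x ∈ segment ℝ p q) : x = p ∨ x = q := by
  obtain ⟨k, rfl⟩ := exists_int_of_level lp lr hd hφ hp hq lx hx
  rw [segment_eq_image'] at hxs
  obtain ⟨t, ⟨ht0, ht1⟩, ht⟩ := hxs
  have : (t - k) • (q - p) = 0 := by
    rw [sub_smul, sub_eq_zero]; exact add_left_cancel ht
  rcases smul_eq_zero.1 this with h | h
  · obtain rfl : t = k := by linarith
    have h0 : 0 ≤ k := by exact_mod_cast ht0
    have h1 : k ≤ 1 := by exact_mod_cast ht1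
    obtain rfl | rfl : k = 0 ∨ k = 1 := by omega
    · left; simp
    · right; simp
  · exact absurd h (ne_of_abs_triDet_eq_one hd)

lemma FaceAdapted.inter {Δ Δ' : Set (ℝ × ℝ)} {p' q' r' : ℝ × ℝ} (h : FaceAdapted φ u Δ p q r)
    {φ' : ℝ × ℝ →L[ℝ] ℝ} {u' : ℝ} (h' : FaceAdapted φ' u' Δ' p' q' r')
    (hu : ∀ z, φ z = u ↔ φ' z = u') (hφ : φ ≠ 0) (hφ' : φ' ≠ 0)
    (hsub : Δ ∩ Δ' ⊆ {z | φ z = u}) : IsFaceOf (Δ ∩ Δ') Δ := by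
  obtain ⟨lp, lq, lr, hd, hΔ, hF⟩ := h
  obtain ⟨lp', lq', lr', hd', hΔ', hF'⟩ := h'
  have hset : {z | φ' z = u'} = {z | φ z = u} := by ext z; exact (hu z).symm
  rw [hset] at hF'
  have hI : Δ ∩ Δ' = (Δ ∩ {z | φ z = u}) ∩ (Δ' ∩ {z | φ z = u}) := by
    ext z
    constructor
    · intro hz
      exact ⟨⟨hz.1, hsub hz⟩, ⟨hz.2, hsub hz⟩⟩
    · intro hz
      exact ⟨hz.1.1, hz.2.1⟩
  have hor : Δ ∩ Δ' = ∅ ∨ Δ ∩ Δ' = {p} ∨ Δ ∩ Δ' = {q} ∨ Δ ∩ Δ' = segment ℝ p q := by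
    rw [hI]
    rcases hF with hF | ⟨hp, hF⟩ | ⟨hp, hq, hF⟩
    · left; rw [hF, Set.empty_inter]
    · rw [hF]
      by_cases hm : p ∈ Δ' ∩ {z | φ z = u}
      · right; left; exact Set.inter_eq_left.2 (by simpa using hm)
      · left; exact Set.singleton_inter_eq_empty.2 hm
    · rw [hF]
      rcases hF' with hF' | ⟨hp', hF'⟩ | ⟨hp', hq', hF'⟩
      · left; rw [hF', Set.inter_empty]
      · rw [hF']
        by_cases hm : p' ∈ segment ℝ p q
        · rcases isLatticePoint_mem_segment lp lr hd hφ hp hq lp' ((hu _).2 hp') hm with h | h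
          · right; left; rw [Set.inter_eq_right.2 (Set.singleton_subset_iff.2 hm), h]
          · right; right; left; rw [Set.inter_eq_right.2 (Set.singleton_subset_iff.2 hm), h]
        · left; exact Set.inter_singleton_eq_empty.2 hm
      · rw [hF']
        obtain ⟨k, hk⟩ := exists_int_of_level lp lr hd hφ hp hq lp' ((hu _).2 hp')
        obtain ⟨m, hm⟩ := exists_int_of_level lp lr hd hφ hp hq lq' ((hu _).2 hq')
        obtain ⟨k', hk'⟩ := exists_int_of_level lp' lr' hd' hφ' hp' hq' lp ((hu _).1 hp)
        obtain ⟨m', hm'⟩ := exists_int_of_level lp' lr' hd' hφ' hp' hq' lq ((hu _).1 hq)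
        have hv := ne_of_abs_triDet_eq_one hd
        have e1 : q' - p' = ((m : ℝ) - k) • (q - p) := by rw [hm, hk]; module
        have e2 : q - p = ((m' : ℝ) - k') • (q' - p') := by
          nth_rw 1 [hm', hk']; module
        have e3 : ((m' : ℝ) - k') * (m - k) = 1 := by
          have : (((m' : ℝ) - k') * (m - k) - 1) • (q - p) = 0 := by
            rw [sub_smul, mul_smul, ← e1, ← e2, one_smul, sub_self]
          rcases smul_eq_zero.1 this with h | h
          · linarith
          · exact absurd h hv
        have e4 : (m' - k') * (m - k) = 1 := by exact_mod_cast e3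
        have e5 : m - k = 1 ∨ m - k = -1 := by
          rcases Int.isUnit_iff.1 (IsUnit.of_mul_eq_one_right _ e4) with h | h <;> omega
        rcases e5 with e5 | e5
        · have := segment_inter_shift (q - p) hv (show q = p + (q - p) by abel) k
          rw [← hk, show ((k : ℝ) + 1) = (m : ℝ) by
            rw [show m = k + 1 by omega]; push_cast; ring, ← hm] at this
          exact this
        · have := segment_inter_shift (q - p) hv (show q = p + (q - p) by abel) m
          rw [← hm, show ((m : ℝ) + 1) = (k : ℝ) by
            rw [show k = m + 1 by omega]; push_cast; ring, ← hk, segment_symm ℝ q' p'] at this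
          exact this
  refine ⟨p, q, r, affineIndependent_of_triDet_ne_zero ?_, hΔ, by tauto⟩
  intro h0
  rw [h0] at hd
  simp at hd

end Faces

/-- Unimodular triangles with disjoint interiors meet in a common face. -/
lemma IsUnimodularTriangle.isFaceOf_inter {Δ Δ' : Set (ℝ × ℝ)} (h : IsUnimodularTriangle Δ)
    (h' : IsUnimodularTriangle Δ') (hdis : Disjoint (interior Δ) (interior Δ')) :
    IsFaceOf (Δ ∩ Δ') Δ ∧ IsFaceOf (Δ ∩ Δ') Δ' := by
  obtain ⟨φ, u, hφ1, hφ2⟩ := geometric_hahn_banach_open_open h.convex.interior isOpen_interior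
    h'.convex.interior isOpen_interior hdis
  obtain ⟨z0, hz0⟩ := h.interior_nonempty
  obtain ⟨z1, hz1⟩ := h'.interior_nonempty
  have hle : ∀ z ∈ Δ, φ z ≤ u := fun z hz =>
    h.subset_of_interior_subset (isClosed_le φ.continuous continuous_const)
      (fun z hz => (hφ1 z hz).le) hz
  have hge : ∀ z ∈ Δ', u ≤ φ z := fun z hz =>
    h'.subset_of_interior_subset (isClosed_le continuous_const φ.continuous)
      (fun z hz => (hφ2 z hz).le) hz
  have hφ : φ ≠ 0 := by
    rintro rfl
    have a := hφ1 _ hz0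
    have b := hφ2 _ hz1
    simp at a b
    linarith
  obtain ⟨p, q, r, hf⟩ := h.exists_faceAdapted hle ⟨z0, interior_subset hz0, hφ1 _ hz0⟩
  obtain ⟨p', q', r', hf'⟩ := h'.exists_faceAdapted (φ := -φ) (u := -u)
    (fun z hz => by simpa using hge z hz) ⟨z1, interior_subset hz1, by simpa using hφ2 _ hz1⟩
  have hu : ∀ z, φ z = u ↔ (-φ) z = -u := fun z => by simp
  have hsub : Δ ∩ Δ' ⊆ {z | φ z = u} := fun z hz => le_antisymm (hle z hz.1) (hge z hz.2)
  refine ⟨hf.inter hf' hu hφ (neg_ne_zero.2 hφ) hsub, ?_⟩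
  rw [Set.inter_comm]
  refine hf'.inter hf (fun z => (hu z).symm) (neg_ne_zero.2 hφ) hφ ?_
  intro z hz
  exact (hu z).1 (hsub ⟨hz.2, hz.1⟩)

/-- `T` is a unimodular triangulation of `P` up to null sets. -/
structure IsTiling (P : Set (ℝ × ℝ)) (T : Set (Set (ℝ × ℝ))) : Prop where
  finite : T.Finite
  isUnimodularTriangle : ∀ Δ ∈ T, IsUnimodularTriangle Δ
  subset : ∀ Δ ∈ T, Δ ⊆ P
  null_diff : volume (P \ ⋃₀ T) = 0
  null_inter : ∀ Δ₁ ∈ T, ∀ Δ₂ ∈ T, Δ₁ ≠ Δ₂ → volume (Δ₁ ∩ Δ₂) = 0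

/-- The number of unimodular triangulations of `P` up to null sets. -/
def numTilings (P : Set (ℝ × ℝ)) : ℕ := Nat.card {T // IsTiling P T}

lemma disjoint_interior_of_volume_inter {s t : Set (ℝ × ℝ)} (h : volume (s ∩ t) = 0) :
    Disjoint (interior s) (interior t) := by
  rw [Set.disjoint_iff_inter_eq_empty, ← interior_inter]
  by_contra hne
  exact (Measure.measure_pos_of_nonempty_interior volume
    (Set.nonempty_iff_ne_empty.2 hne)).ne' h

namespace IsTiling

variable {P : Set (ℝ × ℝ)} {T : Set (Set (ℝ × ℝ))} {Δ Δ' : Set (ℝ × ℝ)} {z : ℝ × ℝ}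

lemma eq_of_mem_interior (h : IsTiling P T) (hΔ : Δ ∈ T) (hΔ' : Δ' ∈ T) (hz : z ∈ interior Δ)
    (hz' : z ∈ Δ') : Δ = Δ' := by
  by_contra hne
  have hd := disjoint_interior_of_volume_inter (h.null_inter _ hΔ _ hΔ' hne)
  have hc := (h.isUnimodularTriangle _ hΔ').subset_closure_interior hz'
  rw [mem_closure_iff] at hc
  obtain ⟨w, hw⟩ := hc _ isOpen_interior hz
  exact Set.disjoint_left.1 hd hw.1 hw.2

lemma sUnion_eq (h : IsTiling P T) (hc : Convex ℝ P) (hne : (interior P).Nonempty) :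
    P ⊆ ⋃₀ T := by
  have hcl : IsClosed (⋃₀ T) := by
    rw [Set.sUnion_eq_biUnion]
    exact h.finite.isClosed_biUnion fun Δ hΔ => (h.isUnimodularTriangle Δ hΔ).isClosed
  have h1 : interior P ⊆ ⋃₀ T := by
    by_contra hn
    have h2 : (interior P \ ⋃₀ T).Nonempty := by
      rwa [Set.sdiff_nonempty]
    have h3 : IsOpen (interior P \ ⋃₀ T) := isOpen_interior.sdiff hcl
    refine (h3.measure_pos volume h2).ne' (measure_mono_null ?_ h.null_diff)
    exact Set.sdiff_subset_sdiff_left interior_subset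
  refine subset_closure.trans ?_
  rw [← hc.closure_interior_eq_closure_of_nonempty_interior hne]
  exact closure_minimal h1 hcl

end IsTiling

lemma volume_segment (p q : ℝ × ℝ) (hpq : p ≠ q) : volume (segment ℝ p q) = 0 := by
  refine measure_mono_null ?_ (volume_line (a := q.2 - p.2) (b := p.1 - q.1)
    (c := (q.2 - p.2) * p.1 + (p.1 - q.1) * p.2) ?_)
  · rintro z ⟨a, b, ha, hb, hab, rfl⟩
    obtain rfl : a = 1 - b := by linarith
    simp
    ring
  · by_contra! h
    apply hpq
    ext
    · linarith [h.2]
    · linarith [h.1]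

lemma IsFaceOf.volume_eq_zero {F Δ : Set (ℝ × ℝ)} (h : IsFaceOf F Δ) (hne : F ≠ Δ) :
    volume F = 0 := by
  obtain ⟨p, q, r, hi, -, h⟩ := h
  have h01 : p ≠ q := fun h => by simpa using hi.injective.ne (show (0 : Fin 3) ≠ 1 by decide) h
  have h02 : p ≠ r := fun h => by simpa using hi.injective.ne (show (0 : Fin 3) ≠ 2 by decide) h
  have h12 : q ≠ r := fun h => by simpa using hi.injective.ne (show (1 : Fin 3) ≠ 2 by decide) h
  rcases h with rfl | rfl | rfl | rfl | rfl | rfl | rfl | h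
  · simp
  · simp
  · simp
  · simp
  · exact volume_segment _ _ h01
  · exact volume_segment _ _ h12
  · exact volume_segment _ _ h02
  · exact absurd h hne

lemma isUnimodularTriangulation_iff_isTiling {P : Set (ℝ × ℝ)} {T : Set (Set (ℝ × ℝ))}
    (hc : Convex ℝ P) (hne : (interior P).Nonempty) :
    IsUnimodularTriangulation P T ↔ IsTiling P T := by
  constructor
  · rintro ⟨h1, h2, h3, h4⟩
    refine ⟨h1, fun Δ hΔ => (h2 Δ hΔ).1, fun Δ hΔ => (h2 Δ hΔ).2, by simp [h3], ?_⟩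
    intro Δ₁ hΔ₁ Δ₂ hΔ₂ hn
    obtain ⟨f1, f2⟩ := h4 Δ₁ hΔ₁ Δ₂ hΔ₂
    by_cases e1 : Δ₁ ∩ Δ₂ = Δ₁
    · by_cases e2 : Δ₁ ∩ Δ₂ = Δ₂
      · exact absurd (e1.symm.trans e2) hn
      · exact f2.volume_eq_zero e2
    · exact f1.volume_eq_zero e1
  · intro h
    refine ⟨h.finite, fun Δ hΔ => ⟨h.isUnimodularTriangle Δ hΔ, h.subset Δ hΔ⟩,
      Set.Subset.antisymm (Set.sUnion_subset h.subset) (h.sUnion_eq hc hne), ?_⟩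
    intro Δ₁ hΔ₁ Δ₂ hΔ₂
    by_cases e : Δ₁ = Δ₂
    · subst e
      obtain ⟨p, q, r, -, -, -, hi, hΔ, -⟩ := h.isUnimodularTriangle _ hΔ₁
      have : IsFaceOf Δ₁ Δ₁ := ⟨p, q, r, hi, hΔ, by tauto⟩
      rw [Set.inter_self]
      exact ⟨this, this⟩
    · exact (h.isUnimodularTriangle _ hΔ₁).isFaceOf_inter (h.isUnimodularTriangle _ hΔ₂)
        (disjoint_interior_of_volume_inter (h.null_inter _ hΔ₁ _ hΔ₂ e))

lemma numTriangulations_eq_numTilings {P : Set (ℝ × ℝ)} (hc : Convex ℝ P)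
    (hne : (interior P).Nonempty) : numTriangulations P = numTilings P := by
  unfold numTriangulations numTilings
  rw [← Nat.card_coe_set_eq]
  exact Nat.card_congr (Equiv.subtypeEquivRight fun T =>
    isUnimodularTriangulation_iff_isTiling hc hne)

/-- Tilings compatible with a dissection of `P` into finitely many pieces. -/
lemma card_tilings_compatible {ι : Type*} [Fintype ι] {P : Set (ℝ × ℝ)} (Q : ι → Set (ℝ × ℝ))
    (hsub : ∀ i, Q i ⊆ P) (hcov : P ⊆ ⋃ i, Q i)
    (hdis : ∀ i j, i ≠ j → volume (Q i ∩ Q j) = 0) :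
    Nat.card {T // IsTiling P T ∧ ∀ Δ ∈ T, ∃ i, Δ ⊆ Q i} = ∏ i, numTilings (Q i) := by
  unfold numTilings
  rw [← Nat.card_pi]
  have huniq : ∀ Δ, IsUnimodularTriangle Δ → ∀ i j, Δ ⊆ Q i → Δ ⊆ Q j → i = j := by
    intro Δ hΔ i j hi hj
    by_contra hne
    exact hΔ.volume_pos.ne' (measure_mono_null (Set.subset_inter hi hj) (hdis i j hne))
  refine Nat.card_congr
    { toFun := fun T i => ⟨{Δ ∈ T.1 | Δ ⊆ Q i}, ?_⟩
      invFun := fun t => ⟨⋃ i, (t i).1, ?_, ?_⟩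
      left_inv := ?_
      right_inv := ?_ }
  · obtain ⟨T, hT, hcomp⟩ := T
    refine ⟨hT.finite.subset (Set.sep_subset _ _), fun Δ hΔ => hT.isUnimodularTriangle Δ hΔ.1,
      fun Δ hΔ => hΔ.2, ?_, fun Δ₁ h₁ Δ₂ h₂ => hT.null_inter _ h₁.1 _ h₂.1⟩
    have hn : volume ((P \ ⋃₀ T) ∪ ⋃ j : {j // j ≠ i}, Q i ∩ Q j) = 0 := by
      rw [measure_union_null_iff, measure_iUnion_null_iff]
      exact ⟨hT.null_diff, fun j => hdis _ _ j.2.symm⟩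
    refine measure_mono_null ?_ hn
    rintro z ⟨hz, hz'⟩
    by_cases hzT : z ∈ ⋃₀ T
    · right
      obtain ⟨Δ, hΔ, hzΔ⟩ := hzT
      obtain ⟨j, hj⟩ := hcomp Δ hΔ
      refine Set.mem_iUnion.2 ⟨⟨j, ?_⟩, hz, hj hzΔ⟩
      rintro rfl
      exact hz' ⟨Δ, ⟨hΔ, hj⟩, hzΔ⟩
    · left
      exact ⟨hsub i hz, hzT⟩
  · refine ⟨Set.finite_iUnion fun i => (t i).2.finite, ?_, ?_, ?_, ?_⟩
    · intro Δ hΔ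
      obtain ⟨i, hi⟩ := Set.mem_iUnion.1 hΔ
      exact (t i).2.isUnimodularTriangle Δ hi
    · intro Δ hΔ
      obtain ⟨i, hi⟩ := Set.mem_iUnion.1 hΔ
      exact ((t i).2.subset Δ hi).trans (hsub i)
    · have hn : volume (⋃ i, Q i \ ⋃₀ (t i).1) = 0 := by
        rw [measure_iUnion_null_iff]
        exact fun i => (t i).2.null_diff
      refine measure_mono_null ?_ hn
      rintro z ⟨hz, hz'⟩
      obtain ⟨i, hi⟩ := Set.mem_iUnion.1 (hcov hz)
      refine Set.mem_iUnion.2 ⟨i, hi, ?_⟩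
      rintro ⟨Δ, hΔ, hzΔ⟩
      exact hz' ⟨Δ, Set.mem_iUnion.2 ⟨i, hΔ⟩, hzΔ⟩
    · intro Δ₁ h₁ Δ₂ h₂ hne
      obtain ⟨i, hi⟩ := Set.mem_iUnion.1 h₁
      obtain ⟨j, hj⟩ := Set.mem_iUnion.1 h₂
      by_cases hij : i = j
      · subst hij
        exact (t i).2.null_inter _ hi _ hj hne
      · exact measure_mono_null (Set.inter_subset_inter ((t i).2.subset _ hi)
          ((t j).2.subset _ hj)) (hdis i j hij)
  · intro Δ hΔ
    obtain ⟨i, hi⟩ := Set.mem_iUnion.1 hΔ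
    exact ⟨i, (t i).2.subset Δ hi⟩
  · rintro ⟨T, hT, hcomp⟩
    apply Subtype.ext
    ext Δ
    simp only [Set.mem_iUnion, Set.mem_ofPred_eq]
    exact ⟨fun ⟨i, hi, _⟩ => hi, fun h => (hcomp Δ h).imp fun i hi => ⟨h, hi⟩⟩
  · intro t
    funext i
    apply Subtype.ext
    ext Δ
    simp only [Set.mem_iUnion, Set.mem_ofPred_eq]
    constructor
    · rintro ⟨⟨j, hj⟩, hi⟩
      obtain rfl := huniq Δ ((t j).2.isUnimodularTriangle Δ hj) j i ((t j).2.subset Δ hj) hi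
      exact hj
    · intro h
      exact ⟨⟨i, h⟩, (t i).2.subset Δ h⟩

/-- The only lattice triangle inside a unimodular triangle is the triangle itself. -/
lemma IsUnimodularTriangle.eq_of_subset {Δ Δ' : Set (ℝ × ℝ)} (h : IsUnimodularTriangle Δ)
    (h' : IsUnimodularTriangle Δ') (hsub : Δ' ⊆ Δ) : Δ' = Δ := by
  obtain ⟨p, q, r, lp, lq, lr, hd, rfl⟩ := isUnimodularTriangle_iff.1 h
  obtain ⟨p', q', r', lp', lq', lr', hd', rfl⟩ := isUnimodularTriangle_iff.1 h'
  have key : ∀ x, IsLatticePoint x → x ∈ convexHull ℝ {p, q, r} → x = p ∨ x = q ∨ x = r := by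
    intro x lx hx
    rw [convexHull_eq_triDet hd] at hx
    obtain ⟨h1, h2, h3⟩ := hx
    obtain ⟨a, ha⟩ := lp.triDet_eq_intCast lq lx
    obtain ⟨b, hb⟩ := lq.triDet_eq_intCast lr lx
    obtain ⟨c, hc⟩ := lr.triDet_eq_intCast lp lx
    rw [ha] at h1
    rw [hb] at h2
    rw [hc] at h3
    have hs : a + b + c = 1 := by
      have : (a : ℝ) + b + c = 1 := by
        rw [← ha, ← hb, ← hc, ← hd]; simp only [triDet]; ring
      exact_mod_cast this
    have h1' : 0 ≤ a := by exact_mod_cast h1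
    have h2' : 0 ≤ b := by exact_mod_cast h2
    have h3' : 0 ≤ c := by exact_mod_cast h3
    have ex : x.1 = b * p.1 + c * q.1 + a * r.1 := by
      rw [← ha, ← hb, ← hc]; simp only [triDet] at hd ⊢; linear_combination (-x.1) * hd
    have ey : x.2 = b * p.2 + c * q.2 + a * r.2 := by
      rw [← ha, ← hb, ← hc]; simp only [triDet] at hd ⊢; linear_combination (-x.2) * hd
    obtain ⟨rfl, rfl, rfl⟩ | ⟨rfl, rfl, rfl⟩ | ⟨rfl, rfl, rfl⟩ :
        (a = 0 ∧ b = 1 ∧ c = 0) ∨ (a = 0 ∧ b = 0 ∧ c = 1) ∨ (a = 1 ∧ b = 0 ∧ c = 0) := by omega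
    · left; ext <;> simp [ex, ey]
    · right; left; ext <;> simp [ex, ey]
    · right; right; ext <;> simp [ex, ey]
  have kp := key p' lp' (hsub (subset_convexHull _ _ (by simp)))
  have kq := key q' lq' (hsub (subset_convexHull _ _ (by simp)))
  have kr := key r' lr' (hsub (subset_convexHull _ _ (by simp)))
  have s1 : ({p, q, r} : Set (ℝ × ℝ)) = {q, r, p} := by
    rw [Set.insert_comm, Set.pair_comm]
  have s2 : ({p, q, r} : Set (ℝ × ℝ)) = {r, p, q} := by
    rw [Set.pair_comm, Set.insert_comm]
  rcases kp with rfl | rfl | rfl <;> rcases kq with rfl | rfl | rfl <;>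
    rcases kr with rfl | rfl | rfl <;>
    first
    | rfl
    | (exfalso; simp only [triDet] at hd'; linarith)
    | (exfalso; simp only [triDet] at hd hd'; linarith)
    | (rw [s1]; done)
    | rw [s2]

lemma isTiling_singleton {Δ : Set (ℝ × ℝ)} (h : IsUnimodularTriangle Δ) : IsTiling Δ {Δ} :=
  ⟨Set.finite_singleton _, by simpa, by simp, by simp, by
    intro a ha b hb hab; exact absurd (ha.trans hb.symm) hab⟩

lemma numTilings_triangle {Δ : Set (ℝ × ℝ)} (h : IsUnimodularTriangle Δ) : numTilings Δ = 1 := by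
  unfold numTilings
  rw [Nat.card_eq_one_iff_unique]
  refine ⟨⟨?_⟩, ⟨⟨{Δ}, isTiling_singleton h⟩⟩⟩
  have key : ∀ T, IsTiling Δ T → T = {Δ} := by
    intro T hT
    have hsub : T ⊆ {Δ} := fun Δ' hΔ' =>
      h.eq_of_subset (hT.isUnimodularTriangle _ hΔ') (hT.subset _ hΔ')
    rcases Set.subset_singleton_iff_eq.1 hsub with rfl | h1
    · have := hT.null_diff
      simp [h.volume_pos.ne'] at this
    · exact h1
  rintro ⟨T, hT⟩ ⟨T', hT'⟩
  exact Subtype.ext ((key T hT).trans (key T' hT').symm)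

lemma numTilings_null {P : Set (ℝ × ℝ)} (h : volume P = 0) : numTilings P = 1 := by
  unfold numTilings
  rw [Nat.card_eq_one_iff_unique]
  have key : ∀ T, IsTiling P T → T = ∅ := by
    intro T hT
    rw [Set.eq_empty_iff_forall_notMem]
    intro Δ hΔ
    exact (hT.isUnimodularTriangle _ hΔ).volume_pos.ne' (measure_mono_null (hT.subset _ hΔ) h)
  refine ⟨⟨?_⟩, ⟨⟨∅, Set.finite_empty, by simp, by simp, by simpa, by simp⟩⟩⟩
  rintro ⟨T, hT⟩ ⟨T', hT'⟩
  exact Subtype.ext ((key T hT).trans (key T' hT').symm)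

lemma finite_isTiling {P : Set (ℝ × ℝ)} {a b c d : ℤ}
    (hP : P ⊆ Set.Icc (a : ℝ) b ×ˢ Set.Icc (c : ℝ) d) : {T | IsTiling P T}.Finite := by
  have hfin : {Δ | IsUnimodularTriangle Δ ∧ Δ ⊆ P}.Finite := by
    let B : Set (ℤ × ℤ) := Set.Icc a b ×ˢ Set.Icc c d
    have hB : B.Finite := (Set.finite_Icc a b).prod (Set.finite_Icc c d)
    let e : ℤ × ℤ → ℝ × ℝ := fun z => ((z.1 : ℝ), (z.2 : ℝ))
    refine ((hB.prod (hB.prod hB)).image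
      fun w => convexHull ℝ {e w.1, e w.2.1, e w.2.2}).subset ?_
    rintro Δ ⟨hΔ, hs⟩
    obtain ⟨p, q, r, lp, lq, lr, -, rfl⟩ := isUnimodularTriangle_iff.1 hΔ
    have hmem : ∀ x, IsLatticePoint x → x ∈ P → ∃ w ∈ B, e w = x := by
      rintro x ⟨i, j, rfl⟩ hx
      obtain ⟨⟨h1, h2⟩, h3, h4⟩ := hP hx
      dsimp only at h1 h2 h3 h4
      exact ⟨(i, j), ⟨⟨by exact_mod_cast h1, by exact_mod_cast h2⟩,
        by exact_mod_cast h3, by exact_mod_cast h4⟩, rfl⟩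
    obtain ⟨u, hu, rfl⟩ := hmem p lp (hs (subset_convexHull _ _ (by simp)))
    obtain ⟨v, hv, rfl⟩ := hmem q lq (hs (subset_convexHull _ _ (by simp)))
    obtain ⟨w, hw, rfl⟩ := hmem r lr (hs (subset_convexHull _ _ (by simp)))
    exact ⟨(u, v, w), ⟨hu, hv, hw⟩, rfl⟩
  refine hfin.finite_subsets.subset ?_
  intro T hT Δ hΔ
  exact ⟨hT.isUnimodularTriangle Δ hΔ, hT.subset Δ hΔ⟩

lemma mem_convexHull_triple_left (p q r : ℝ × ℝ) : p ∈ convexHull ℝ {p, q, r} :=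
  subset_convexHull _ _ (by simp)

lemma mem_convexHull_triple_middle (p q r : ℝ × ℝ) : q ∈ convexHull ℝ {p, q, r} :=
  subset_convexHull _ _ (by simp)

lemma mem_convexHull_triple_right (p q r : ℝ × ℝ) : r ∈ convexHull ℝ {p, q, r} :=
  subset_convexHull _ _ (by simp)

/-- The unimodular triangle with an edge of length one on the line `x = x₀` and a vertex on
`x = x₀ + 1`. -/
def leftTriangle (x₀ a b : ℤ) : Set (ℝ × ℝ) :=
  convexHull ℝ {((x₀ : ℝ), (a : ℝ)), ((x₀ : ℝ) + 1, (b : ℝ)), ((x₀ : ℝ), (a : ℝ) + 1)}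

/-- The unimodular triangle with an edge of length one on the line `x = x₀ + 1` and a vertex on
`x = x₀`. -/
def rightTriangle (x₀ a b : ℤ) : Set (ℝ × ℝ) :=
  convexHull ℝ {((x₀ : ℝ), (a : ℝ)), ((x₀ : ℝ) + 1, (b : ℝ)), ((x₀ : ℝ) + 1, (b : ℝ) + 1)}

lemma isUnimodularTriangle_leftTriangle (x₀ a b : ℤ) :
    IsUnimodularTriangle (leftTriangle x₀ a b) :=
  isUnimodularTriangle_iff.2 ⟨_, _, _, ⟨x₀, a, rfl⟩, ⟨x₀ + 1, b, by simp⟩, ⟨x₀, a + 1, by simp⟩,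
    by simp [triDet], rfl⟩

lemma isUnimodularTriangle_rightTriangle (x₀ a b : ℤ) :
    IsUnimodularTriangle (rightTriangle x₀ a b) :=
  isUnimodularTriangle_iff.2 ⟨_, _, _, ⟨x₀, a, rfl⟩, ⟨x₀ + 1, b, by simp⟩,
    ⟨x₀ + 1, b + 1, by simp⟩, by simp [triDet], rfl⟩

lemma mem_leftTriangle {x₀ a b : ℤ} {z : ℝ × ℝ} : z ∈ leftTriangle x₀ a b ↔
    (x₀ : ℝ) ≤ z.1 ∧ (a : ℝ) + (b - a) * (z.1 - x₀) ≤ z.2 ∧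
      z.2 ≤ (a : ℝ) + 1 + (b - (a + 1)) * (z.1 - x₀) := by
  rw [leftTriangle, convexHull_eq_triDet (by simp [triDet])]
  simp only [triDet, Set.mem_ofPred_eq]
  constructor
  · rintro ⟨h1, h2, h3⟩; refine ⟨?_, ?_, ?_⟩ <;> linarith
  · rintro ⟨h1, h2, h3⟩; refine ⟨?_, ?_, ?_⟩ <;> linarith

lemma mem_rightTriangle {x₀ a b : ℤ} {z : ℝ × ℝ} : z ∈ rightTriangle x₀ a b ↔
    z.1 ≤ (x₀ : ℝ) + 1 ∧ (a : ℝ) + (b - a) * (z.1 - x₀) ≤ z.2 ∧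
      z.2 ≤ (a : ℝ) + (b + 1 - a) * (z.1 - x₀) := by
  rw [rightTriangle, convexHull_eq_triDet (by simp [triDet])]
  simp only [triDet, Set.mem_ofPred_eq]
  constructor
  · rintro ⟨h1, h2, h3⟩; refine ⟨?_, ?_, ?_⟩ <;> linarith
  · rintro ⟨h1, h2, h3⟩; refine ⟨?_, ?_, ?_⟩ <;> linarith

/-- Classification of the unimodular triangles in a strip of width one. -/
lemma IsUnimodularTriangle.eq_left_or_right {Δ : Set (ℝ × ℝ)} (h : IsUnimodularTriangle Δ)
    {x₀ : ℤ} (hs : ∀ z ∈ Δ, (x₀ : ℝ) ≤ z.1 ∧ z.1 ≤ x₀ + 1) :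
    ∃ a b : ℤ, Δ = leftTriangle x₀ a b ∨ Δ = rightTriangle x₀ a b := by
  obtain ⟨p, q, r, ⟨x1, y1, rfl⟩, ⟨x2, y2, rfl⟩, ⟨x3, y3, rfl⟩, hd, rfl⟩ :=
    isUnimodularTriangle_iff.1 h
  have h1 := hs _ (mem_convexHull_triple_left _ _ _)
  have h2 := hs _ (mem_convexHull_triple_middle _ _ _)
  have h3 := hs _ (mem_convexHull_triple_right _ _ _)
  clear hs h
  have hx : ∀ x : ℤ, ((x₀ : ℝ) ≤ x ∧ (x : ℝ) ≤ x₀ + 1) → x = x₀ ∨ x = x₀ + 1 := by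
    rintro x ⟨h1, h2⟩
    have h1 : x₀ ≤ x := by exact_mod_cast h1
    have h2 : x ≤ x₀ + 1 := by exact_mod_cast h2
    omega
  have s1 : ∀ p q r : ℝ × ℝ, ({p, q, r} : Set (ℝ × ℝ)) = {q, r, p} := by
    intro p q r
    rw [Set.insert_comm, Set.pair_comm]
  have hd' : (x2 - x1) * (y3 - y1) - (y2 - y1) * (x3 - x1) = 1 := by
    simp only [triDet] at hd
    exact_mod_cast hd
  clear hd
  rcases hx _ h1 with rfl | rfl <;> rcases hx _ h2 with rfl | rfl <;>
    rcases hx _ h3 with rfl | rfl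
  · simp at hd'
  · refine ⟨y2, y3, Or.inl ?_⟩
    obtain rfl : y1 = y2 + 1 := by linarith
    rw [leftTriangle, s1]
    push_cast; rfl
  · refine ⟨y1, y2, Or.inl ?_⟩
    obtain rfl : y3 = y1 + 1 := by linarith
    rw [leftTriangle]
    push_cast; rfl
  · refine ⟨y1, y2, Or.inr ?_⟩
    obtain rfl : y3 = y2 + 1 := by linarith
    rw [rightTriangle]
    push_cast; rfl
  · refine ⟨y3, y1, Or.inl ?_⟩
    obtain rfl : y2 = y3 + 1 := by linarith
    rw [leftTriangle, s1, s1]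
    push_cast; rfl
  · refine ⟨y2, y3, Or.inr ?_⟩
    obtain rfl : y1 = y3 + 1 := by linarith
    rw [rightTriangle, s1]
    push_cast; rfl
  · refine ⟨y3, y1, Or.inr ?_⟩
    obtain rfl : y2 = y1 + 1 := by linarith
    rw [rightTriangle, s1, s1]
    push_cast; rfl
  · exact absurd hd' (by simp)

/-- The width-one trapezoid between the segment from `(x₀, s)` to `(x₀ + 1, t)` and the segment
from `(x₀, s')` to `(x₀ + 1, t')`. -/
def strip (x₀ s t s' t' : ℤ) : Set (ℝ × ℝ) :=
  {z | (x₀ : ℝ) ≤ z.1 ∧ z.1 ≤ x₀ + 1 ∧ (s : ℝ) + (t - s) * (z.1 - x₀) ≤ z.2 ∧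
    z.2 ≤ (s' : ℝ) + (t' - s') * (z.1 - x₀)}

lemma isClosed_strip (x₀ s t s' t' : ℤ) : IsClosed (strip x₀ s t s' t') := by
  have h1 : IsClosed {z : ℝ × ℝ | (x₀ : ℝ) ≤ z.1} :=
    isClosed_le (by fun_prop) (by fun_prop)
  have h2 : IsClosed {z : ℝ × ℝ | z.1 ≤ (x₀ : ℝ) + 1} :=
    isClosed_le (by fun_prop) (by fun_prop)
  have h3 : IsClosed {z : ℝ × ℝ | (s : ℝ) + (t - s) * (z.1 - x₀) ≤ z.2} :=
    isClosed_le (by fun_prop) (by fun_prop)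
  have h4 : IsClosed {z : ℝ × ℝ | z.2 ≤ (s' : ℝ) + (t' - s') * (z.1 - x₀)} :=
    isClosed_le (by fun_prop) (by fun_prop)
  exact h1.inter (h2.inter (h3.inter h4))

lemma convex_strip (x₀ s t s' t' : ℤ) : Convex ℝ (strip x₀ s t s' t') := by
  rintro ⟨x, y⟩ ⟨h1, h2, h3, h4⟩ ⟨x', y'⟩ ⟨h1', h2', h3', h4'⟩ a b ha hb hab
  obtain rfl : a = 1 - b := by linarith
  simp only [strip, Set.mem_ofPred_eq, Prod.smul_mk, Prod.mk_add_mk, smul_eq_mul] at *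
  refine ⟨?_, ?_, ?_, ?_⟩
  · linear_combination (1 - b) * h1 + b * h1'
  · linear_combination (1 - b) * h2 + b * h2'
  · linear_combination (1 - b) * h3 + b * h3'
  · linear_combination (1 - b) * h4 + b * h4'

lemma interior_strip_nonempty {x₀ s t s' t' : ℤ} (h : s + t < s' + t') :
    (interior (strip x₀ s t s' t')).Nonempty := by
  have h' : (s : ℝ) + t < s' + t' := by exact_mod_cast h
  refine ⟨((x₀ : ℝ) + 1 / 2, ((s : ℝ) + t + s' + t') / 4), mem_interior.2
    ⟨{z | (x₀ : ℝ) < z.1 ∧ z.1 < x₀ + 1 ∧ (s : ℝ) + (t - s) * (z.1 - x₀) < z.2 ∧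
      z.2 < (s' : ℝ) + (t' - s') * (z.1 - x₀)}, ?_, ?_, ?_⟩⟩
  · rintro z ⟨h1, h2, h3, h4⟩
    exact ⟨h1.le, h2.le, h3.le, h4.le⟩
  · have h1 : IsOpen {z : ℝ × ℝ | (x₀ : ℝ) < z.1} :=
      isOpen_lt (by fun_prop) (by fun_prop)
    have h2 : IsOpen {z : ℝ × ℝ | z.1 < (x₀ : ℝ) + 1} :=
      isOpen_lt (by fun_prop) (by fun_prop)
    have h3 : IsOpen {z : ℝ × ℝ | (s : ℝ) + (t - s) * (z.1 - x₀) < z.2} :=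
      isOpen_lt (by fun_prop) (by fun_prop)
    have h4 : IsOpen {z : ℝ × ℝ | z.2 < (s' : ℝ) + (t' - s') * (z.1 - x₀)} :=
      isOpen_lt (by fun_prop) (by fun_prop)
    exact h1.inter (h2.inter (h3.inter h4))
  · refine ⟨?_, ?_, ?_, ?_⟩ <;> dsimp only <;> linarith

lemma finite_isTiling_strip (x₀ s t s' t' : ℤ) : {T | IsTiling (strip x₀ s t s' t') T}.Finite := by
  refine finite_isTiling (a := x₀) (b := x₀ + 1) (c := min s t) (d := max s' t') ?_
  rintro ⟨x, y⟩ ⟨h1, h2, h3, h4⟩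
  dsimp only at *
  refine ⟨⟨h1, by push_cast; exact h2⟩, ?_, ?_⟩
  · have e1 : ((min s t : ℤ) : ℝ) ≤ s := by exact_mod_cast min_le_left s t
    have e2 : ((min s t : ℤ) : ℝ) ≤ t := by exact_mod_cast min_le_right s t
    dsimp only
    nlinarith
  · have e1 : (s' : ℝ) ≤ (max s' t' : ℤ) := by exact_mod_cast le_max_left s' t'
    have e2 : (t' : ℝ) ≤ (max s' t' : ℤ) := by exact_mod_cast le_max_right s' t'
    dsimp only
    nlinarith

namespace IsTiling

variable {x₀ s t s' t' : ℤ} {T : Set (Set (ℝ × ℝ))}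

lemma left_or_right_mem (h : IsTiling (strip x₀ s t s' t') T) (hs : s ≤ s') (ht : t ≤ t')
    (hst : s + t < s' + t') :
    leftTriangle x₀ (s' - 1) t' ∈ T ∨ rightTriangle x₀ s' (t' - 1) ∈ T := by
  have hst' : (s : ℝ) + t < s' + t' := by exact_mod_cast hst
  have hm : (((x₀ : ℝ) + 1 / 2, ((s' : ℝ) + t') / 2) : ℝ × ℝ) ∈ ⋃₀ T := by
    apply h.sUnion_eq (convex_strip _ _ _ _ _) (interior_strip_nonempty hst)
    refine ⟨?_, ?_, ?_, ?_⟩ <;> dsimp only <;> linarith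
  obtain ⟨Δ, hΔ, hz⟩ := hm
  have hsub := h.subset Δ hΔ
  obtain ⟨a, b, hab⟩ := (h.isUnimodularTriangle Δ hΔ).eq_left_or_right (x₀ := x₀)
    (fun z hz => ⟨(hsub hz).1, (hsub hz).2.1⟩)
  rcases hab with rfl | rfl
  · left
    have h1 := (hsub (mem_convexHull_triple_right _ _ _)).2.2.2
    have h2 := (hsub (mem_convexHull_triple_middle _ _ _)).2.2.2
    rw [mem_leftTriangle] at hz
    have h3 := hz.2.2
    dsimp only at h1 h2 h3
    ring_nf at h1 h2 h3
    have h1' : 1 + a ≤ s' := by exact_mod_cast h1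
    have h2' : b ≤ t' := by exact_mod_cast h2
    have h3' : (s' : ℝ) + t' ≤ a + 1 + b := by linarith
    have h3' : s' + t' ≤ a + 1 + b := by exact_mod_cast h3'
    obtain rfl : a = s' - 1 := by omega
    obtain rfl : b = t' := by omega
    exact hΔ
  · right
    have h1 := (hsub (mem_convexHull_triple_right _ _ _)).2.2.2
    have h2 := (hsub (mem_convexHull_triple_left _ _ _)).2.2.2
    rw [mem_rightTriangle] at hz
    have h3 := hz.2.2
    dsimp only at h1 h2 h3
    ring_nf at h1 h2 h3
    have h1' : 1 + b ≤ t' := by exact_mod_cast h1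
    have h2' : a ≤ s' := by exact_mod_cast h2
    have h3' : (s' : ℝ) + t' ≤ a + 1 + b := by linarith
    have h3' : s' + t' ≤ a + 1 + b := by exact_mod_cast h3'
    obtain rfl : b = t' - 1 := by omega
    obtain rfl : a = s' := by omega
    exact hΔ

lemma not_left_and_right (h : IsTiling (strip x₀ s t s' t') T)
    (hl : leftTriangle x₀ (s' - 1) t' ∈ T) : rightTriangle x₀ s' (t' - 1) ∉ T := by
  intro hr
  have hz : (((x₀ : ℝ) + 1 / 2, ((s' : ℝ) + t') / 2 - 1 / 4) : ℝ × ℝ) ∈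
      interior (leftTriangle x₀ (s' - 1) t') := by
    apply mem_interior_of_triDet_pos <;> simp only [triDet] <;> push_cast <;> linarith
  have := h.eq_of_mem_interior hl hr hz (by
    rw [mem_rightTriangle]; push_cast; refine ⟨?_, ?_, ?_⟩ <;> linarith)
  have h2 : ((x₀ : ℝ), (s' : ℝ) - 1) ∈ rightTriangle x₀ s' (t' - 1) := by
    rw [← this]
    rw [mem_leftTriangle]; push_cast; refine ⟨?_, ?_, ?_⟩ <;> linarith
  rw [mem_rightTriangle] at h2
  push_cast at h2
  linarith [h2.1, h2.2.1]

/-- A triangle of a tiling other than the piece `Δ` lies in the rest of the region. -/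
lemma subset_or_eq {P Q Δ Δ' : Set (ℝ × ℝ)} (h : IsTiling P T) (hΔ : Δ ∈ T) (hQ : IsClosed Q)
    (hcov : P ⊆ Q ∪ Δ) (hΔ' : Δ' ∈ T) : Δ' ⊆ Q ∨ Δ' ⊆ Δ := by
  by_cases e : Δ' = Δ
  · exact Or.inr e.subset
  · left
    apply (h.isUnimodularTriangle _ hΔ').subset_of_interior_subset hQ
    intro z hz
    rcases hcov (h.subset _ hΔ' (interior_subset hz)) with h1 | h1
    · exact h1
    · exact absurd (h.eq_of_mem_interior hΔ' hΔ hz h1) e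

lemma mem_of_subset_or_null {P Δ : Set (ℝ × ℝ)} (h : IsTiling P T) (hΔ : IsUnimodularTriangle Δ)
    (hΔP : Δ ⊆ P) (hT : ∀ Δ' ∈ T, Δ' ⊆ Δ ∨ volume (Δ' ∩ Δ) = 0) : Δ ∈ T := by
  by_contra hn
  refine hΔ.volume_pos.ne' (measure_mono_null (t := (⋃ Δ' ∈ T, Δ' ∩ Δ) ∪ (P \ ⋃₀ T)) ?_ ?_)
  · intro z hz
    by_cases hzT : z ∈ ⋃₀ T
    · left
      obtain ⟨Δ', hΔ', hzΔ'⟩ := hzT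
      exact Set.mem_biUnion hΔ' ⟨hzΔ', hz⟩
    · exact Or.inr ⟨hΔP hz, hzT⟩
  · rw [measure_union_null_iff, measure_biUnion_null_iff h.finite.countable]
    refine ⟨fun Δ' hΔ' => (hT Δ' hΔ').resolve_left fun hs => hn ?_, h.null_diff⟩
    rwa [← hΔ.eq_of_subset (h.isUnimodularTriangle _ hΔ') hs]

end IsTiling

/-- Removing a triangle from a region. -/
lemma card_tilings_of_mem {P Q Δ : Set (ℝ × ℝ)} (hΔ : IsUnimodularTriangle Δ) (hQ : IsClosed Q)
    (hQP : Q ⊆ P) (hΔP : Δ ⊆ P) (hcov : P ⊆ Q ∪ Δ) (hdis : volume (Q ∩ Δ) = 0) :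
    Nat.card {T // IsTiling P T ∧ Δ ∈ T} = numTilings Q := by
  have := card_tilings_compatible (P := P) ![Q, Δ] (by simp [Fin.forall_fin_two, hQP, hΔP])
    (by intro z hz; simpa [Set.mem_iUnion, Fin.exists_fin_two] using hcov hz)
    (by simp [Fin.forall_fin_two, hdis, Set.inter_comm Δ Q])
  rw [Fin.prod_univ_two] at this
  simp only [Matrix.cons_val_zero, Matrix.cons_val_one, numTilings_triangle hΔ, mul_one] at this
  rw [← this]
  refine Nat.card_congr (Equiv.subtypeEquivRight fun T => and_congr_right fun hT => ?_)
  simp only [Fin.exists_fin_two, Matrix.cons_val_zero, Matrix.cons_val_one]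
  constructor
  · intro h Δ' hΔ'
    exact hT.subset_or_eq h hQ hcov hΔ'
  · intro h
    refine hT.mem_of_subset_or_null hΔ hΔP fun Δ' hΔ' => (h Δ' hΔ').symm.imp_right fun h1 => ?_
    exact measure_mono_null (Set.inter_subset_inter_left _ h1) hdis

lemma card_tilings_strip_left {x₀ s t s' t' : ℤ} (hs : s ≤ s') (ht : t ≤ t') :
    Nat.card {T // IsTiling (strip x₀ s t (s' + 1) t') T ∧ leftTriangle x₀ s' t' ∈ T} =
      numTilings (strip x₀ s t s' t') := by
  have hs' : (s : ℝ) ≤ s' := by exact_mod_cast hs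
  have ht' : (t : ℝ) ≤ t' := by exact_mod_cast ht
  refine card_tilings_of_mem (isUnimodularTriangle_leftTriangle _ _ _) (isClosed_strip _ _ _ _ _)
    ?_ ?_ ?_ ?_
  · rintro ⟨x, y⟩ ⟨h1, h2, h3, h4⟩
    dsimp only at *
    refine ⟨h1, h2, h3, ?_⟩
    push_cast
    linarith
  · rintro ⟨x, y⟩ h
    rw [mem_leftTriangle] at h
    obtain ⟨h1, h2, h3⟩ := h
    dsimp only at *
    have h4 : x ≤ x₀ + 1 := by linarith
    refine ⟨h1, h4, ?_, ?_⟩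
    · dsimp only; nlinarith
    · push_cast; exact h3
  · rintro ⟨x, y⟩ ⟨h1, h2, h3, h4⟩
    rcases le_total y (s' + (t' - s') * (x - x₀)) with h | h
    · exact Or.inl ⟨h1, h2, h3, h⟩
    · right
      rw [mem_leftTriangle]
      push_cast at h4
      exact ⟨h1, h, h4⟩
  · refine measure_mono_null ?_ (volume_line (a := (t' : ℝ) - s') (b := -1)
      (c := (t' - s') * x₀ - s') (by simp))
    rintro ⟨x, y⟩ ⟨⟨h1, h2, h3, h4⟩, h⟩
    rw [mem_leftTriangle] at h
    simp only [Set.mem_ofPred_eq] at *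
    linarith [h.2.1]

lemma card_tilings_strip_right {x₀ s t s' t' : ℤ} (hs : s ≤ s') (ht : t ≤ t') :
    Nat.card {T // IsTiling (strip x₀ s t s' (t' + 1)) T ∧ rightTriangle x₀ s' t' ∈ T} =
      numTilings (strip x₀ s t s' t') := by
  have hs' : (s : ℝ) ≤ s' := by exact_mod_cast hs
  have ht' : (t : ℝ) ≤ t' := by exact_mod_cast ht
  refine card_tilings_of_mem (isUnimodularTriangle_rightTriangle _ _ _) (isClosed_strip _ _ _ _ _)
    ?_ ?_ ?_ ?_
  · rintro ⟨x, y⟩ ⟨h1, h2, h3, h4⟩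
    dsimp only at *
    refine ⟨h1, h2, h3, ?_⟩
    push_cast
    linarith
  · rintro ⟨x, y⟩ h
    rw [mem_rightTriangle] at h
    obtain ⟨h1, h2, h3⟩ := h
    dsimp only at *
    have h4 : x₀ ≤ x := by linarith
    refine ⟨h4, h1, ?_, ?_⟩
    · dsimp only; nlinarith
    · push_cast; exact h3
  · rintro ⟨x, y⟩ ⟨h1, h2, h3, h4⟩
    rcases le_total y (s' + (t' - s') * (x - x₀)) with h | h
    · exact Or.inl ⟨h1, h2, h3, h⟩
    · right
      rw [mem_rightTriangle]
      push_cast at h4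
      exact ⟨h2, h, h4⟩
  · refine measure_mono_null ?_ (volume_line (a := (t' : ℝ) - s') (b := -1)
      (c := (t' - s') * x₀ - s') (by simp))
    rintro ⟨x, y⟩ ⟨⟨h1, h2, h3, h4⟩, h⟩
    rw [mem_rightTriangle] at h
    simp only [Set.mem_ofPred_eq] at *
    linarith [h.2.1]

lemma numTilings_eq_ncard (P : Set (ℝ × ℝ)) : numTilings P = {T | IsTiling P T}.ncard := by
  rw [← Nat.card_coe_set_eq]; rfl

/-- Deleting the triangle at the top edge of a strip. -/
lemma numTilings_strip_eq_add {x₀ s t s' t' : ℤ} (hs : s ≤ s') (ht : t ≤ t')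
    (hst : s + t < s' + t') :
    numTilings (strip x₀ s t s' t') =
      Nat.card {T // IsTiling (strip x₀ s t s' t') T ∧ leftTriangle x₀ (s' - 1) t' ∈ T} +
      Nat.card {T // IsTiling (strip x₀ s t s' t') T ∧ rightTriangle x₀ s' (t' - 1) ∈ T} := by
  have hfin := finite_isTiling_strip x₀ s t s' t'
  rw [numTilings_eq_ncard]
  have := Set.ncard_union_eq (s := {T | IsTiling (strip x₀ s t s' t') T ∧
    leftTriangle x₀ (s' - 1) t' ∈ T}) (t := {T | IsTiling (strip x₀ s t s' t') T ∧
    rightTriangle x₀ s' (t' - 1) ∈ T}) ?_ (hfin.subset fun T hT => hT.1)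
    (hfin.subset fun T hT => hT.1)
  · rw [← Nat.card_coe_set_eq, ← Nat.card_coe_set_eq] at this
    refine Eq.trans ?_ this
    congr 1
    ext T
    constructor
    · intro hT
      exact (hT.left_or_right_mem hs ht hst).imp (fun h => ⟨hT, h⟩) fun h => ⟨hT, h⟩
    · rintro (h | h)
      · exact h.1
      · exact h.1
  · rw [Set.disjoint_left]
    rintro T ⟨hT, h1⟩ ⟨-, h2⟩
    exact hT.not_left_and_right h1 h2

lemma card_tilings_strip_left_eq_zero {x₀ s t t' : ℤ} :
    Nat.card {T // IsTiling (strip x₀ s t s t') T ∧ leftTriangle x₀ (s - 1) t' ∈ T} = 0 := by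
  rw [Nat.card_eq_zero]
  left
  refine ⟨fun ⟨T, hT, h⟩ => ?_⟩
  have := (hT.subset _ h (mem_convexHull_triple_left _ _ _)).2.2.1
  push_cast at this
  linarith

lemma card_tilings_strip_right_eq_zero {x₀ s t s' : ℤ} :
    Nat.card {T // IsTiling (strip x₀ s t s' t) T ∧ rightTriangle x₀ s' (t - 1) ∈ T} = 0 := by
  rw [Nat.card_eq_zero]
  left
  refine ⟨fun ⟨T, hT, h⟩ => ?_⟩
  have := (hT.subset _ h (mem_convexHull_triple_middle _ _ _)).2.2.1
  push_cast at this
  linarith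

/-- The number of unimodular triangulations of a strip of width one. -/
lemma numTilings_strip (x₀ s t : ℤ) (i j : ℕ) :
    numTilings (strip x₀ s t (s + i) (t + j)) = (i + j).choose i := by
  induction i generalizing j with
  | zero =>
    induction j with
    | zero =>
      rw [numTilings_null]
      · simp
      · refine measure_mono_null ?_ (volume_line (a := (t : ℝ) - s) (b := -1)
          (c := (t - s) * x₀ - s) (by simp))
        rintro ⟨x, y⟩ ⟨h1, h2, h3, h4⟩
        push_cast at *
        simp only [Set.mem_ofPred_eq, add_zero] at *
        linarith
    | succ j ih =>
      have h1 := card_tilings_strip_right (x₀ := x₀) (s := s) (t := t) (s' := s + (0 : ℕ))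
        (t' := t + j) (by omega) (by omega)
      have h2 := card_tilings_strip_left_eq_zero (x₀ := x₀) (s := s) (t := t) (t' := t + j + 1)
      rw [ih] at h1
      rw [numTilings_strip_eq_add (by omega) (by omega) (by omega)]
      simp only [Nat.cast_zero, add_zero, Nat.cast_succ, ← add_assoc, add_sub_cancel_right] at *
      rw [h1, h2]
      simp
  | succ i ih =>
    induction j with
    | zero =>
      have h1 := card_tilings_strip_left (x₀ := x₀) (s := s) (t := t) (s' := s + i)
        (t' := t + (0 : ℕ)) (by omega) (by omega)
      have h2 := card_tilings_strip_right_eq_zero (x₀ := x₀) (s := s) (t := t) (s' := s + i + 1)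
      rw [ih] at h1
      rw [numTilings_strip_eq_add (by omega) (by omega) (by omega)]
      simp only [Nat.cast_zero, add_zero, Nat.cast_succ, ← add_assoc, add_sub_cancel_right] at *
      rw [h1, h2]
      simp
    | succ j ih' =>
      have h1 := card_tilings_strip_left (x₀ := x₀) (s := s) (t := t) (s' := s + i)
        (t' := t + (j + 1 : ℕ)) (by omega) (by omega)
      have h2 := card_tilings_strip_right (x₀ := x₀) (s := s) (t := t) (s' := s + (i + 1 : ℕ))
        (t' := t + j) (by omega) (by omega)
      rw [ih] at h1
      rw [ih'] at h2
      rw [numTilings_strip_eq_add (by omega) (by omega) (by omega)]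
      simp only [Nat.cast_succ, ← add_assoc, add_sub_cancel_right] at *
      rw [h1, h2, Nat.choose_succ_succ (i + 1 + j) i]
      congr 2
      omega

/-- The triangle with vertices `(0, a)`, `(2, b)` and `(1, c)`. -/
def crossingTriangle (a b c : ℤ) : Set (ℝ × ℝ) :=
  convexHull ℝ {((0 : ℝ), (a : ℝ)), ((2 : ℝ), (b : ℝ)), ((1 : ℝ), (c : ℝ))}

lemma crossingTriangle_eq (a b c : ℤ) : crossingTriangle a b c =
    convexHull ℝ {((0 : ℝ), (a : ℝ)), ((1 : ℝ), (c : ℝ)), ((2 : ℝ), (b : ℝ))} := by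
  rw [crossingTriangle, Set.pair_comm]

section Crossing

variable {a b c : ℤ} {z : ℝ × ℝ}

lemma triDet_upper (h : 2 * c = a + b + 1) :
    triDet ((0 : ℝ), (a : ℝ)) ((2 : ℝ), (b : ℝ)) ((1 : ℝ), (c : ℝ)) = 1 := by
  have h' : (2 * c : ℝ) = a + b + 1 := by exact_mod_cast h
  simp only [triDet]; linarith

lemma triDet_lower (h : 2 * c + 1 = a + b) :
    triDet ((0 : ℝ), (a : ℝ)) ((1 : ℝ), (c : ℝ)) ((2 : ℝ), (b : ℝ)) = 1 := by
  have h' : (2 * c + 1 : ℝ) = a + b := by exact_mod_cast h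
  simp only [triDet]; linarith

lemma isUnimodularTriangle_crossingTriangle (h : 2 * c = a + b + 1) :
    IsUnimodularTriangle (crossingTriangle a b c) :=
  isUnimodularTriangle_iff.2 ⟨_, _, _, ⟨0, a, by simp⟩, ⟨2, b, by simp⟩, ⟨1, c, by simp⟩,
    triDet_upper h, rfl⟩

lemma mem_crossingTriangle_upper (h : 2 * c = a + b + 1) : z ∈ crossingTriangle a b c ↔
    2 * (a : ℝ) + (b - a) * z.1 ≤ 2 * z.2 ∧ z.2 ≤ a + (c - a) * z.1 ∧
      z.2 ≤ b + (c - b) * (2 - z.1) := by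
  rw [crossingTriangle, convexHull_eq_triDet (triDet_upper h)]
  simp only [triDet, Set.mem_ofPred_eq]
  constructor
  · rintro ⟨h1, h2, h3⟩; refine ⟨?_, ?_, ?_⟩ <;> linarith
  · rintro ⟨h1, h2, h3⟩; refine ⟨?_, ?_, ?_⟩ <;> linarith

lemma mem_crossingTriangle_lower (h : 2 * c + 1 = a + b) : z ∈ crossingTriangle a b c ↔
    2 * z.2 ≤ 2 * (a : ℝ) + (b - a) * z.1 ∧ a + (c - a) * z.1 ≤ z.2 ∧
      b + (c - b) * (2 - z.1) ≤ z.2 := by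
  rw [crossingTriangle_eq, convexHull_eq_triDet (triDet_lower h)]
  simp only [triDet, Set.mem_ofPred_eq]
  constructor
  · rintro ⟨h1, h2, h3⟩; refine ⟨?_, ?_, ?_⟩ <;> linarith
  · rintro ⟨h1, h2, h3⟩; refine ⟨?_, ?_, ?_⟩ <;> linarith

lemma center_mem_interior_crossingTriangle (h : 2 * c = a + b + 1 ∨ 2 * c + 1 = a + b) :
    (((1 : ℝ), ((a : ℝ) + b + 2 * c) / 4) : ℝ × ℝ) ∈ interior (crossingTriangle a b c) := by
  rcases h with h | h
  · have h' : (2 * c : ℝ) = a + b + 1 := by exact_mod_cast h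
    apply mem_interior_of_triDet_pos (triDet_upper h) <;> simp only [triDet] <;> linarith
  · have h' : (2 * c + 1 : ℝ) = a + b := by exact_mod_cast h
    rw [crossingTriangle_eq]
    apply mem_interior_of_triDet_pos (triDet_lower h) <;> simp only [triDet] <;> linarith

end Crossing

/-- Classification of the unimodular triangles in a strip of width two. -/
lemma IsUnimodularTriangle.crossing_or_le_or_ge {Δ : Set (ℝ × ℝ)} (h : IsUnimodularTriangle Δ)
    (hs : ∀ z ∈ Δ, 0 ≤ z.1 ∧ z.1 ≤ 2) :
    (∃ a b c : ℤ, (2 * c = a + b + 1 ∨ 2 * c + 1 = a + b) ∧ Δ = crossingTriangle a b c) ∨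
      (∀ z ∈ Δ, z.1 ≤ 1) ∨ ∀ z ∈ Δ, 1 ≤ z.1 := by
  obtain ⟨p, q, r, ⟨x1, y1, rfl⟩, ⟨x2, y2, rfl⟩, ⟨x3, y3, rfl⟩, hd, rfl⟩ :=
    isUnimodularTriangle_iff.1 h
  have h1 := hs _ (mem_convexHull_triple_left _ _ _)
  have h2 := hs _ (mem_convexHull_triple_middle _ _ _)
  have h3 := hs _ (mem_convexHull_triple_right _ _ _)
  clear hs h
  have hx : ∀ x : ℤ, ((0 : ℝ) ≤ x ∧ (x : ℝ) ≤ 2) → x = 0 ∨ x = 1 ∨ x = 2 := by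
    rintro x ⟨h1, h2⟩
    have h1 : 0 ≤ x := by exact_mod_cast h1
    have h2 : x ≤ 2 := by exact_mod_cast h2
    omega
  have s1 : ∀ p q r : ℝ × ℝ, ({p, q, r} : Set (ℝ × ℝ)) = {q, r, p} := by
    intro p q r
    rw [Set.insert_comm, Set.pair_comm]
  have hd' : (x2 - x1) * (y3 - y1) - (y2 - y1) * (x3 - x1) = 1 := by
    simp only [triDet] at hd
    exact_mod_cast hd
  clear hd
  have hle : x1 ≤ 1 → x2 ≤ 1 → x3 ≤ 1 → ∀ z ∈ convexHull ℝ
      {((x1 : ℝ), (y1 : ℝ)), ((x2 : ℝ), (y2 : ℝ)), ((x3 : ℝ), (y3 : ℝ))}, z.1 ≤ 1 := by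
    intro h1 h2 h3 z hz
    refine convexHull_min ?_ (convex_halfSpace_le (f := Prod.fst) ⟨by simp, by simp⟩ (1 : ℝ)) hz
    rintro w (rfl | rfl | rfl)
    · show (x1 : ℝ) ≤ 1
      exact_mod_cast h1
    · show (x2 : ℝ) ≤ 1
      exact_mod_cast h2
    · show (x3 : ℝ) ≤ 1
      exact_mod_cast h3
  have hge : 1 ≤ x1 → 1 ≤ x2 → 1 ≤ x3 → ∀ z ∈ convexHull ℝ
      {((x1 : ℝ), (y1 : ℝ)), ((x2 : ℝ), (y2 : ℝ)), ((x3 : ℝ), (y3 : ℝ))}, 1 ≤ z.1 := by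
    intro h1 h2 h3 z hz
    refine convexHull_min ?_ (convex_halfSpace_ge (f := Prod.fst) ⟨by simp, by simp⟩ (1 : ℝ)) hz
    rintro w (rfl | rfl | rfl)
    · show 1 ≤ (x1 : ℝ)
      exact_mod_cast h1
    · show 1 ≤ (x2 : ℝ)
      exact_mod_cast h2
    · show 1 ≤ (x3 : ℝ)
      exact_mod_cast h3
  rcases hx _ h1 with rfl | rfl | rfl <;> rcases hx _ h2 with rfl | rfl | rfl <;>
    rcases hx _ h3 with rfl | rfl | rfl <;>
    first
    | (exfalso; omega)
    | (right; left; refine hle ?_ ?_ ?_ <;> omega)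
    | (right; right; refine hge ?_ ?_ ?_ <;> omega)
    | (refine Or.inl ⟨y1, y2, y3, by omega, ?_⟩; rw [crossingTriangle]; push_cast; rfl)
    | (refine Or.inl ⟨y2, y3, y1, by omega, ?_⟩; rw [crossingTriangle, s1]; push_cast; rfl)
    | (refine Or.inl ⟨y3, y1, y2, by omega, ?_⟩; rw [crossingTriangle, s1, s1]; push_cast; rfl)
    | (refine Or.inl ⟨y1, y3, y2, by omega, ?_⟩; rw [crossingTriangle_eq]; push_cast; rfl)
    | (refine Or.inl ⟨y2, y1, y3, by omega, ?_⟩; rw [crossingTriangle_eq, s1]; push_cast; rfl)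
    | (refine Or.inl ⟨y3, y2, y1, by omega, ?_⟩; rw [crossingTriangle_eq, s1, s1]; push_cast; rfl)

/-- The rectangle `[0, 2] × [0, n]`. -/
def rect (n : ℕ) : Set (ℝ × ℝ) := Set.Icc (0, 0) (2, (n : ℝ))

lemma mem_rect {n : ℕ} {z : ℝ × ℝ} :
    z ∈ rect n ↔ 0 ≤ z.1 ∧ z.1 ≤ 2 ∧ 0 ≤ z.2 ∧ z.2 ≤ n := by
  simp only [rect, Set.mem_Icc, Prod.le_def]
  tauto

lemma convex_rect (n : ℕ) : Convex ℝ (rect n) := convex_Icc _ _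

lemma interior_rect_nonempty {n : ℕ} (hn : 1 ≤ n) : (interior (rect n)).Nonempty := by
  rw [rect, Set.Icc_prod_eq, interior_prod_eq, interior_Icc, interior_Icc]
  refine ⟨(1, 1 / 2), ⟨by norm_num, by norm_num⟩, by norm_num, ?_⟩
  have : (1 : ℝ) ≤ n := by exact_mod_cast hn
  simp only
  linarith

lemma finite_isTiling_rect (n : ℕ) : {T | IsTiling (rect n) T}.Finite := by
  refine finite_isTiling (a := 0) (b := 2) (c := 0) (d := n) ?_
  intro z hz
  obtain ⟨h1, h2, h3, h4⟩ := mem_rect.1 hz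
  exact ⟨⟨by simpa, by simpa⟩, by simpa, by simpa⟩

namespace IsTiling

variable {n : ℕ} {T : Set (Set (ℝ × ℝ))}

/-- The topmost triangle crossing the middle line has its apex on top. -/
lemma exists_top_crossing (h : IsTiling (rect n) T) (hn : 1 ≤ n)
    (hex : ∃ a b c : ℤ, (2 * c = a + b + 1 ∨ 2 * c + 1 = a + b) ∧ crossingTriangle a b c ∈ T) :
    ∃ a b c : ℤ, 2 * c = a + b + 1 ∧ crossingTriangle a b c ∈ T ∧
      ∀ a' b' c' : ℤ, (2 * c' = a' + b' + 1 ∨ 2 * c' + 1 = a' + b') →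
        crossingTriangle a' b' c' ∈ T → a' + b' + 2 * c' ≤ a + b + 2 * c := by
  have hbd : ∀ a b c : ℤ, crossingTriangle a b c ∈ T → a ≤ n ∧ b ≤ n ∧ 0 ≤ c ∧ c ≤ n := by
    intro a b c hT
    have h1 := (mem_rect.1 (h.subset _ hT (mem_convexHull_triple_left _ _ _))).2.2.2
    have h2 := (mem_rect.1 (h.subset _ hT (mem_convexHull_triple_middle _ _ _))).2.2.2
    have h3 := (mem_rect.1 (h.subset _ hT (mem_convexHull_triple_right _ _ _))).2.2
    dsimp only at h1 h2 h3
    exact ⟨by exact_mod_cast h1, by exact_mod_cast h2, by exact_mod_cast h3.1,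
      by exact_mod_cast h3.2⟩
  obtain ⟨k, ⟨a, b, c, hc, hT, hk⟩, hmax⟩ := Int.exists_greatest_of_bdd
    (P := fun k => ∃ a b c : ℤ, (2 * c = a + b + 1 ∨ 2 * c + 1 = a + b) ∧
      crossingTriangle a b c ∈ T ∧ a + b + 2 * c = k)
    ⟨4 * n, by
      rintro k ⟨a, b, c, -, hT, rfl⟩
      obtain ⟨h1, h2, -, h3⟩ := hbd a b c hT
      omega⟩
    (by
      obtain ⟨a, b, c, hc, hT⟩ := hex
      exact ⟨_, a, b, c, hc, hT, rfl⟩)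
  refine ⟨a, b, c, ?_, hT, fun a' b' c' hc' hT' => hk ▸ hmax _ ⟨a', b', c', hc', hT', rfl⟩⟩
  refine hc.resolve_right fun hlow => ?_
  obtain ⟨ha, hb, hc0, hcn⟩ := hbd a b c hT
  have hcn' : c + 1 ≤ n := by omega
  have hcnR : (c : ℝ) + 1 ≤ n := by exact_mod_cast hcn'
  have hc0R : (0 : ℝ) ≤ c := by exact_mod_cast hc0
  have hlowR : 2 * (c : ℝ) + 1 = a + b := by exact_mod_cast hlow
  obtain ⟨Δ, hΔ, hz⟩ := h.sUnion_eq (convex_rect n) (interior_rect_nonempty hn)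
    (show (((1 : ℝ), (c : ℝ) + 3 / 4) : ℝ × ℝ) ∈ rect n by
      rw [mem_rect]; refine ⟨?_, ?_, ?_, ?_⟩ <;> dsimp only <;> linarith)
  have hcen := center_mem_interior_crossingTriangle hc
  have hov : ∀ Δ ∈ T, (((1 : ℝ), ((a : ℝ) + b + 2 * c) / 4) : ℝ × ℝ) ∈ Δ →
      (((1 : ℝ), (c : ℝ) + 3 / 4) : ℝ × ℝ) ∉ Δ := by
    intro Δ hΔ h1 h2
    rw [← h.eq_of_mem_interior hT hΔ hcen h1, mem_crossingTriangle_lower hlow] at h2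
    have := h2.1
    dsimp only at this
    linarith
  have hsub := h.subset Δ hΔ
  rcases (h.isUnimodularTriangle Δ hΔ).crossing_or_le_or_ge
    (fun z hz => ⟨(mem_rect.1 (hsub hz)).1, (mem_rect.1 (hsub hz)).2.1⟩) with
    ⟨a', b', c', hc', rfl⟩ | hside | hside
  · have hm := hmax _ ⟨a', b', c', hc', hΔ, rfl⟩
    rcases hc' with hc' | hc'
    · have hz' := ((mem_crossingTriangle_upper hc').1 hz).2.1
      dsimp only at hz'
      have : (c : ℝ) < c' := by linarith
      have : c < c' := by exact_mod_cast this
      omega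
    · have hz' := ((mem_crossingTriangle_lower hc').1 hz).1
      have hcR : (2 * c' : ℝ) + 1 = a' + b' := by exact_mod_cast hc'
      dsimp only at hz'
      have : (c : ℝ) < c' := by linarith
      have : c < c' := by exact_mod_cast this
      omega
  · obtain ⟨a', b', rfl | rfl⟩ := (h.isUnimodularTriangle Δ hΔ).eq_left_or_right (x₀ := 0)
      (fun z hz => ⟨by simpa using (mem_rect.1 (hsub hz)).1, by simpa using hside z hz⟩)
    · rw [mem_leftTriangle] at hz
      push_cast at hz
      obtain ⟨h1, h2, h3⟩ := hz
      have e1 : (b' : ℝ) ≤ c + 3 / 4 := by linarith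
      have e2 : (c : ℝ) + 3 / 4 ≤ b' := by linarith
      have f1 : (b' : ℝ) < c + 1 := by linarith
      have f2 : (c : ℝ) < b' := by linarith
      have f1 : b' < c + 1 := by exact_mod_cast f1
      have f2 : c < b' := by exact_mod_cast f2
      omega
    · have hz0 := hz
      rw [mem_rightTriangle] at hz
      push_cast at hz
      obtain ⟨h1, h2, h3⟩ := hz
      have f1 : (b' : ℝ) < c + 1 := by linarith
      have f2 : (c : ℝ) < b' + 1 := by linarith
      have f1 : b' < c + 1 := by exact_mod_cast f1
      have f2 : c < b' + 1 := by exact_mod_cast f2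
      obtain rfl : b' = c := by omega
      refine hov _ hΔ ?_ hz0
      rw [mem_rightTriangle]
      push_cast
      refine ⟨?_, ?_, ?_⟩ <;> linarith
  · obtain ⟨a', b', rfl | rfl⟩ := (h.isUnimodularTriangle Δ hΔ).eq_left_or_right (x₀ := 1)
      (fun z hz => ⟨by simpa using hside z hz, by
        have := (mem_rect.1 (hsub hz)).2.1
        push_cast; linarith⟩)
    · have hz0 := hz
      rw [mem_leftTriangle] at hz
      push_cast at hz
      obtain ⟨h1, h2, h3⟩ := hz
      have f1 : (a' : ℝ) < c + 1 := by linarith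
      have f2 : (c : ℝ) < a' + 1 := by linarith
      have f1 : a' < c + 1 := by exact_mod_cast f1
      have f2 : c < a' + 1 := by exact_mod_cast f2
      obtain rfl : a' = c := by omega
      refine hov _ hΔ ?_ hz0
      rw [mem_leftTriangle]
      push_cast
      refine ⟨?_, ?_, ?_⟩ <;> linarith
    · rw [mem_rightTriangle] at hz
      push_cast at hz
      obtain ⟨h1, h2, h3⟩ := hz
      have f1 : (a' : ℝ) < c + 1 := by linarith
      have f2 : (c : ℝ) < a' := by linarith
      have f1 : a' < c + 1 := by exact_mod_cast f1
      have f2 : c < a' := by exact_mod_cast f2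
      omega

end IsTiling

/-- The reflection of the plane in the line `x = 1`. -/
def mirror (z : ℝ × ℝ) : ℝ × ℝ := (2 - z.1, z.2)

lemma mirror_mirror (z : ℝ × ℝ) : mirror (mirror z) = z := by simp [mirror]

lemma mirror_preimage_preimage (s : Set (ℝ × ℝ)) : mirror ⁻¹' (mirror ⁻¹' s) = s := by
  ext z; simp [mirror_mirror]

lemma volume_mirror_preimage {s : Set (ℝ × ℝ)} (h : volume s = 0) :
    volume (mirror ⁻¹' s) = 0 :=
  (((Measure.measurePreserving_sub_left volume (2 : ℝ)).prod
    (MeasurePreserving.id (volume : Measure ℝ))).quasiMeasurePreserving).preimage_null h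

lemma IsUnimodularTriangle.mirror_preimage {Δ : Set (ℝ × ℝ)} (h : IsUnimodularTriangle Δ) :
    IsUnimodularTriangle (mirror ⁻¹' Δ) := by
  obtain ⟨p, q, r, lp, lq, lr, hd, rfl⟩ := isUnimodularTriangle_iff.1 h
  have hl : ∀ {x}, IsLatticePoint x → IsLatticePoint (mirror x) := by
    rintro _ ⟨i, j, rfl⟩
    exact ⟨2 - i, j, by simp [mirror]⟩
  have hd' : triDet (mirror p) (mirror r) (mirror q) = 1 := by
    rw [← hd]; simp only [triDet, mirror]; ring
  refine isUnimodularTriangle_iff.2 ⟨_, _, _, hl lp, hl lr, hl lq, hd', ?_⟩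
  rw [convexHull_eq_triDet hd, convexHull_eq_triDet hd']
  ext z
  simp only [Set.mem_preimage, Set.mem_ofPred_eq, triDet, mirror]
  constructor
  · rintro ⟨h1, h2, h3⟩; refine ⟨?_, ?_, ?_⟩ <;> linarith
  · rintro ⟨h1, h2, h3⟩; refine ⟨?_, ?_, ?_⟩ <;> linarith

lemma IsTiling.mirror_preimage {P : Set (ℝ × ℝ)} {T : Set (Set (ℝ × ℝ))} (h : IsTiling P T) :
    IsTiling (mirror ⁻¹' P) (Set.preimage mirror '' T) where
  finite := h.finite.image _
  isUnimodularTriangle := by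
    rintro _ ⟨Δ, hΔ, rfl⟩
    exact (h.isUnimodularTriangle Δ hΔ).mirror_preimage
  subset := by
    rintro _ ⟨Δ, hΔ, rfl⟩
    exact Set.preimage_mono (h.subset Δ hΔ)
  null_diff := by
    refine measure_mono_null ?_ (volume_mirror_preimage h.null_diff)
    rintro z ⟨hz, hn⟩
    refine ⟨hz, ?_⟩
    rintro ⟨Δ, hΔ, hz'⟩
    exact hn ⟨_, ⟨Δ, hΔ, rfl⟩, hz'⟩
  null_inter := by
    rintro _ ⟨Δ, hΔ, rfl⟩ _ ⟨Δ', hΔ', rfl⟩ hne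
    exact volume_mirror_preimage (h.null_inter Δ hΔ Δ' hΔ' fun e => hne (by rw [e]))

lemma numTilings_mirror_preimage (P : Set (ℝ × ℝ)) :
    numTilings (mirror ⁻¹' P) = numTilings P := by
  have hinv : ∀ T : Set (Set (ℝ × ℝ)),
      Set.preimage mirror '' (Set.preimage mirror '' T) = T := by
    intro T
    rw [Set.image_image]
    simp [mirror_preimage_preimage]
  exact Nat.card_congr
    { toFun := fun T => ⟨Set.preimage mirror '' T, by
        have := T.2.mirror_preimage
        rwa [mirror_preimage_preimage] at this⟩
      invFun := fun T => ⟨_, T.2.mirror_preimage⟩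
      left_inv := fun T => Subtype.ext (hinv _)
      right_inv := fun T => Subtype.ext (hinv _) }

/-- The trapezoid of width two with vertical sides of lengths `a` and `b`. -/
def trapezoid (a b : ℤ) : Set (ℝ × ℝ) :=
  {z | 0 ≤ z.1 ∧ z.1 ≤ 2 ∧ 0 ≤ z.2 ∧ 2 * z.2 ≤ 2 * (a : ℝ) + (b - a) * z.1}

lemma mirror_preimage_trapezoid (a b : ℤ) : mirror ⁻¹' trapezoid a b = trapezoid b a := by
  ext z
  simp only [trapezoid, mirror, Set.mem_preimage, Set.mem_ofPred_eq]
  constructor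
  · rintro ⟨h1, h2, h3, h4⟩; refine ⟨?_, ?_, ?_, ?_⟩ <;> linarith
  · rintro ⟨h1, h2, h3, h4⟩; refine ⟨?_, ?_, ?_, ?_⟩ <;> linarith

lemma isClosed_trapezoid (a b : ℤ) : IsClosed (trapezoid a b) := by
  have h1 : IsClosed {z : ℝ × ℝ | 0 ≤ z.1} := isClosed_le (by fun_prop) (by fun_prop)
  have h2 : IsClosed {z : ℝ × ℝ | z.1 ≤ 2} := isClosed_le (by fun_prop) (by fun_prop)
  have h3 : IsClosed {z : ℝ × ℝ | 0 ≤ z.2} := isClosed_le (by fun_prop) (by fun_prop)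
  have h4 : IsClosed {z : ℝ × ℝ | 2 * z.2 ≤ 2 * (a : ℝ) + (b - a) * z.1} :=
    isClosed_le (by fun_prop) (by fun_prop)
  exact h1.inter (h2.inter (h3.inter h4))

lemma convex_trapezoid (a b : ℤ) : Convex ℝ (trapezoid a b) := by
  rintro ⟨x, y⟩ ⟨h1, h2, h3, h4⟩ ⟨x', y'⟩ ⟨h1', h2', h3', h4'⟩ s t hs ht hst
  obtain rfl : s = 1 - t := by linarith
  simp only [trapezoid, Set.mem_ofPred_eq, Prod.smul_mk, Prod.mk_add_mk, smul_eq_mul] at *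
  refine ⟨?_, ?_, ?_, ?_⟩
  · linear_combination (1 - t) * h1 + t * h1'
  · linear_combination (1 - t) * h2 + t * h2'
  · linear_combination (1 - t) * h3 + t * h3'
  · linear_combination (1 - t) * h4 + t * h4'

lemma interior_trapezoid_nonempty {a b : ℤ} (h : 1 ≤ a + b) :
    (interior (trapezoid a b)).Nonempty := by
  have h' : (1 : ℝ) ≤ a + b := by exact_mod_cast h
  refine ⟨(1, 1 / 4), mem_interior.2
    ⟨{z | 0 < z.1 ∧ z.1 < 2 ∧ 0 < z.2 ∧ 2 * z.2 < 2 * (a : ℝ) + (b - a) * z.1}, ?_, ?_, ?_⟩⟩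
  · rintro z ⟨h1, h2, h3, h4⟩
    exact ⟨h1.le, h2.le, h3.le, h4.le⟩
  · have h1 : IsOpen {z : ℝ × ℝ | 0 < z.1} := isOpen_lt (by fun_prop) (by fun_prop)
    have h2 : IsOpen {z : ℝ × ℝ | z.1 < 2} := isOpen_lt (by fun_prop) (by fun_prop)
    have h3 : IsOpen {z : ℝ × ℝ | 0 < z.2} := isOpen_lt (by fun_prop) (by fun_prop)
    have h4 : IsOpen {z : ℝ × ℝ | 2 * z.2 < 2 * (a : ℝ) + (b - a) * z.1} :=
      isOpen_lt (by fun_prop) (by fun_prop)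
    exact h1.inter (h2.inter (h3.inter h4))
  · refine ⟨?_, ?_, ?_, ?_⟩ <;> dsimp only <;> linarith

lemma trapezoid_eq_convexHull (A B : ℕ) : trapezoid A B =
    convexHull ℝ {((0 : ℝ), (0 : ℝ)), (2, 0), (0, (A : ℝ)), (2, (B : ℝ))} := by
  have hA : (0 : ℝ) ≤ A := A.cast_nonneg
  have hB : (0 : ℝ) ≤ B := B.cast_nonneg
  apply Set.Subset.antisymm
  · rintro ⟨x, y⟩ ⟨h1, h2, h3, h4⟩
    dsimp only at h1 h2 h3 h4
    push_cast at h4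
    set C := convexHull ℝ {((0 : ℝ), (0 : ℝ)), (2, 0), (0, (A : ℝ)), (2, (B : ℝ))} with hC
    have hc : Convex ℝ C := convex_convexHull _ _
    have hbot : ((x, 0) : ℝ × ℝ) ∈ C := by
      have := hc (subset_convexHull ℝ _ (by simp) : ((0, 0) : ℝ × ℝ) ∈ C)
        (subset_convexHull ℝ _ (by simp) : ((2, 0) : ℝ × ℝ) ∈ C)
        (show 0 ≤ 1 - x / 2 by linarith) (show 0 ≤ x / 2 by linarith) (by ring)
      convert this using 1
      ext <;> simp
    have htop : ((x, A + (B - A) * (x / 2)) : ℝ × ℝ) ∈ C := by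
      have := hc (subset_convexHull ℝ _ (by simp) : ((0, (A : ℝ)) : ℝ × ℝ) ∈ C)
        (subset_convexHull ℝ _ (by simp) : ((2, (B : ℝ)) : ℝ × ℝ) ∈ C)
        (show 0 ≤ 1 - x / 2 by linarith) (show 0 ≤ x / 2 by linarith) (by ring)
      convert this using 1
      ext
      · simp
      · simp; ring
    set e : ℝ := A + (B - A) * (x / 2) with he
    have hye : y ≤ e := by linarith
    rcases (h3.trans hye).eq_or_lt with h0 | h0
    · obtain rfl : y = 0 := by linarith
      exact hbot
    · have := hc hbot htop (show 0 ≤ 1 - y / e by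
        rw [sub_nonneg, div_le_one h0]; exact hye) (show 0 ≤ y / e by positivity) (by ring)
      convert this using 1
      ext
      · simp; ring
      · simp; field_simp
  · refine convexHull_min ?_ (convex_trapezoid _ _)
    rintro z (rfl | rfl | rfl | rfl) <;> refine ⟨?_, ?_, ?_, ?_⟩ <;> push_cast <;>
      linarith

lemma g₂_eq_numTilings {A B : ℕ} (h : 1 ≤ A + B) : g₂ A B = numTilings (trapezoid A B) := by
  rw [g₂, ← trapezoid_eq_convexHull]
  exact numTriangulations_eq_numTilings (convex_trapezoid _ _)
    (interior_trapezoid_nonempty (by exact_mod_cast h))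

lemma g₂_comm {A B : ℕ} (h : 1 ≤ A + B) : g₂ A B = g₂ B A := by
  rw [g₂_eq_numTilings h, g₂_eq_numTilings (by omega), ← mirror_preimage_trapezoid,
    numTilings_mirror_preimage]

lemma mem_strip_zero {a c : ℤ} {n : ℕ} {z : ℝ × ℝ} : z ∈ strip 0 a c n n ↔
    0 ≤ z.1 ∧ z.1 ≤ 1 ∧ (a : ℝ) + (c - a) * z.1 ≤ z.2 ∧ z.2 ≤ n := by
  simp [strip]

lemma mem_strip_one {b c : ℤ} {n : ℕ} {z : ℝ × ℝ} : z ∈ strip 1 c b n n ↔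
    1 ≤ z.1 ∧ z.1 ≤ 2 ∧ (b : ℝ) + (c - b) * (2 - z.1) ≤ z.2 ∧ z.2 ≤ n := by
  simp only [strip, Set.mem_ofPred_eq]
  push_cast
  constructor
  · rintro ⟨h1, h2, h3, h4⟩; refine ⟨?_, ?_, ?_, ?_⟩ <;> linarith
  · rintro ⟨h1, h2, h3, h4⟩; refine ⟨?_, ?_, ?_, ?_⟩ <;> linarith

/-- The decomposition of `[0, 2] × [0, n]` determined by a crossing triangle: the trapezoid below
it, the triangle itself, and the strips of width one above it. -/
def pieces (n : ℕ) (a b c : ℤ) : Fin 4 → Set (ℝ × ℝ) :=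
  ![trapezoid a b, crossingTriangle a b c, strip 0 a c n n, strip 1 c b n n]

section Pieces

variable {n : ℕ} {a b c : ℤ}

lemma pieces_cover (hc : 2 * c = a + b + 1) : rect n ⊆ ⋃ i, pieces n a b c i := by
  rintro ⟨x, y⟩ hz
  obtain ⟨h1, h2, h3, h4⟩ := mem_rect.1 hz
  dsimp only at h1 h2 h3 h4
  have hc' : 2 * (c : ℝ) = a + b + 1 := by exact_mod_cast hc
  have key : (b + (c - b) * (2 - x) : ℝ) - (a + (c - a) * x) = 1 - x := by
    linear_combination (1 - x) * hc'
  rw [Set.mem_iUnion]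
  rcases le_total (2 * y) (2 * (a : ℝ) + (b - a) * x) with h | h
  · exact ⟨0, h1, h2, h3, h⟩
  · rcases le_total x 1 with hx | hx
    · rcases le_total y (a + (c - a) * x) with h' | h'
      · refine ⟨1, (mem_crossingTriangle_upper hc).2 ⟨h, h', ?_⟩⟩
        dsimp only
        linarith
      · exact ⟨2, mem_strip_zero.2 ⟨h1, hx, h', h4⟩⟩
    · rcases le_total y (b + (c - b) * (2 - x)) with h' | h'
      · refine ⟨1, (mem_crossingTriangle_upper hc).2 ⟨h, ?_, h'⟩⟩
        dsimp only
        linarith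
      · exact ⟨3, mem_strip_one.2 ⟨hx, h2, h', h4⟩⟩

lemma pieces_subset (hc : 2 * c = a + b + 1) (ha : 0 ≤ a) (hb : 0 ≤ b) (han : a ≤ n)
    (hbn : b ≤ n) (i : Fin 4) : pieces n a b c i ⊆ rect n := by
  have hcn : c ≤ n := by omega
  have hc0 : 0 ≤ c := by omega
  have ha' : (0 : ℝ) ≤ a := by exact_mod_cast ha
  have hb' : (0 : ℝ) ≤ b := by exact_mod_cast hb
  have hc0' : (0 : ℝ) ≤ c := by exact_mod_cast hc0
  have han' : (a : ℝ) ≤ n := by exact_mod_cast han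
  have hbn' : (b : ℝ) ≤ n := by exact_mod_cast hbn
  have hcn' : (c : ℝ) ≤ n := by exact_mod_cast hcn
  fin_cases i
  · rintro ⟨x, y⟩ ⟨h1, h2, h3, h4⟩
    refine mem_rect.2 ⟨h1, h2, h3, ?_⟩
    dsimp only at *
    nlinarith
  · refine convexHull_min ?_ (convex_rect n)
    rintro z (rfl | rfl | rfl) <;> rw [mem_rect] <;> refine ⟨?_, ?_, ?_, ?_⟩ <;> dsimp only <;>
      linarith
  · intro z hz
    obtain ⟨h1, h2, h3, h4⟩ := mem_strip_zero.1 hz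
    exact mem_rect.2 ⟨h1, by linarith, by nlinarith, h4⟩
  · intro z hz
    obtain ⟨h1, h2, h3, h4⟩ := mem_strip_one.1 hz
    exact mem_rect.2 ⟨by linarith, h2, by nlinarith, h4⟩

lemma volume_pieces_inter (hc : 2 * c = a + b + 1) {i j : Fin 4} (hij : i ≠ j) :
    volume (pieces n a b c i ∩ pieces n a b c j) = 0 := by
  have hc' : 2 * (c : ℝ) = a + b + 1 := by exact_mod_cast hc
  have e1 : ∀ x : ℝ, 2 * (a + (c - a) * x : ℝ) = 2 * a + (b - a) * x + x := fun x => by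
    linear_combination x * hc'
  have e2 : ∀ x : ℝ, 2 * (b + (c - b) * (2 - x) : ℝ) = 2 * a + (b - a) * x + (2 - x) := fun x => by
    linear_combination (2 - x) * hc'
  have hbase := volume_line (a := (b : ℝ) - a) (b := -2) (c := -2 * a) (by simp)
  have h01 : volume (trapezoid a b ∩ crossingTriangle a b c) = 0 := by
    refine measure_mono_null ?_ hbase
    rintro z ⟨⟨-, -, -, h1⟩, h2⟩
    have := ((mem_crossingTriangle_upper hc).1 h2).1
    simp only [Set.mem_ofPred_eq]
    linarith
  have h02 : volume (trapezoid a b ∩ strip 0 a c n n) = 0 := by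
    refine measure_mono_null ?_ hbase
    rintro z ⟨⟨h0, -, -, h1⟩, h2⟩
    have := (mem_strip_zero.1 h2).2.2.1
    simp only [Set.mem_ofPred_eq]
    linarith [e1 z.1]
  have h03 : volume (trapezoid a b ∩ strip 1 c b n n) = 0 := by
    refine measure_mono_null ?_ hbase
    rintro z ⟨⟨-, h0, -, h1⟩, h2⟩
    have := (mem_strip_one.1 h2).2.2.1
    simp only [Set.mem_ofPred_eq]
    linarith [e2 z.1]
  have h12 : volume (crossingTriangle a b c ∩ strip 0 a c n n) = 0 := by
    refine measure_mono_null ?_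
      (volume_line (a := (c : ℝ) - a) (b := -1) (c := -a) (by simp))
    rintro z ⟨h1, h2⟩
    have h1 := ((mem_crossingTriangle_upper hc).1 h1).2.1
    have h2 := (mem_strip_zero.1 h2).2.2.1
    simp only [Set.mem_ofPred_eq]
    linarith
  have h13 : volume (crossingTriangle a b c ∩ strip 1 c b n n) = 0 := by
    refine measure_mono_null ?_
      (volume_line (a := (b : ℝ) - c) (b := -1) (c := b - 2 * c) (by simp))
    rintro z ⟨h1, h2⟩
    have h1 := ((mem_crossingTriangle_upper hc).1 h1).2.2
    have h2 := (mem_strip_one.1 h2).2.2.1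
    simp only [Set.mem_ofPred_eq]
    linarith
  have h23 : volume (strip 0 a c n n ∩ strip 1 c b n n) = 0 := by
    refine measure_mono_null ?_ (volume_line (a := 1) (b := 0) (c := 1) (by simp))
    rintro z ⟨h1, h2⟩
    have h1 := (mem_strip_zero.1 h1).2.1
    have h2 := (mem_strip_one.1 h2).1
    simp only [Set.mem_ofPred_eq]
    linarith
  fin_cases i <;> fin_cases j <;>
    first
    | exact absurd rfl hij
    | exact h01
    | exact h02
    | exact h03
    | exact h12
    | exact h13
    | exact h23
    | (rw [Set.inter_comm]; exact h01)
    | (rw [Set.inter_comm]; exact h02)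
    | (rw [Set.inter_comm]; exact h03)
    | (rw [Set.inter_comm]; exact h12)
    | (rw [Set.inter_comm]; exact h13)
    | (rw [Set.inter_comm]; exact h23)

/-- A tiling is compatible with the decomposition determined by its topmost crossing triangle. -/
lemma IsTiling.exists_subset_pieces {T : Set (Set (ℝ × ℝ))} (h : IsTiling (rect n) T)
    (hc : 2 * c = a + b + 1) (hT : crossingTriangle a b c ∈ T)
    (hmax : ∀ a' b' c' : ℤ, (2 * c' = a' + b' + 1 ∨ 2 * c' + 1 = a' + b') →
      crossingTriangle a' b' c' ∈ T → a' + b' + 2 * c' ≤ a + b + 2 * c) :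
    ∀ Δ ∈ T, ∃ i, Δ ⊆ pieces n a b c i := by
  intro Δ hΔ
  by_cases e : Δ = crossingTriangle a b c
  · exact ⟨1, e.subset⟩
  have hc' : 2 * (c : ℝ) = a + b + 1 := by exact_mod_cast hc
  have key : ∀ x : ℝ, (b + (c - b) * (2 - x) : ℝ) - (a + (c - a) * x) = 1 - x := fun x => by
    linear_combination (1 - x) * hc'
  have e1 : ∀ x : ℝ, 2 * (a + (c - a) * x : ℝ) = 2 * a + (b - a) * x + x := fun x => by
    linear_combination x * hc'
  have hU := h.isUnimodularTriangle Δ hΔ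
  have hsub := h.subset Δ hΔ
  let U : Set (ℝ × ℝ) := {z | 2 * z.2 < 2 * (a : ℝ) + (b - a) * z.1}
  let V : Set (ℝ × ℝ) :=
    {z | (a : ℝ) + (c - a) * z.1 < z.2} ∪ {z | (b : ℝ) + (c - b) * (2 - z.1) < z.2}
  have hUo : IsOpen U := isOpen_lt (by fun_prop) (by fun_prop)
  have hVo : IsOpen V :=
    (isOpen_lt (by fun_prop) (by fun_prop)).union (isOpen_lt (by fun_prop) (by fun_prop))
  have hcov : interior Δ ⊆ U ∪ V := by
    intro z hz
    by_contra hn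
    refine e (h.eq_of_mem_interior hΔ hT hz ((mem_crossingTriangle_upper hc).2 ⟨?_, ?_, ?_⟩))
    · exact not_lt.1 fun h => hn (Or.inl h)
    · exact not_lt.1 fun h => hn (Or.inr (Or.inl h))
    · exact not_lt.1 fun h => hn (Or.inr (Or.inr h))
  have hdis : interior Δ ∩ (U ∩ V) = ∅ := by
    rw [Set.eq_empty_iff_forall_notMem]
    rintro z ⟨hz, h1, h2⟩
    obtain ⟨hz1, hz2, -, -⟩ := mem_rect.1 (hsub (interior_subset hz))
    have h1 : 2 * z.2 < 2 * (a : ℝ) + (b - a) * z.1 := h1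
    rcases h2 with h2 | h2
    · have h2 : (a : ℝ) + (c - a) * z.1 < z.2 := h2
      linarith [e1 z.1]
    · have h2 : (b : ℝ) + (c - b) * (2 - z.1) < z.2 := h2
      linarith [e1 z.1, key z.1]
  rcases isPreconnected_iff_subset_of_disjoint.1 hU.convex.interior.isPreconnected U V hUo hVo
    hcov hdis with hs | hs
  · refine ⟨0, hU.subset_of_interior_subset (isClosed_trapezoid a b) fun z hz => ?_⟩
    obtain ⟨h1, h2, h3, -⟩ := mem_rect.1 (hsub (interior_subset hz))
    exact ⟨h1, h2, h3, le_of_lt (hs hz)⟩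
  · rcases hU.crossing_or_le_or_ge
      (fun z hz => ⟨(mem_rect.1 (hsub hz)).1, (mem_rect.1 (hsub hz)).2.1⟩) with
      ⟨a', b', c', hc₁, rfl⟩ | hside | hside
    · exfalso
      have hm := hmax a' b' c' hc₁ hΔ
      have hm : (a' : ℝ) + b' + 2 * c' ≤ a + b + 2 * c := by exact_mod_cast hm
      rcases hs (center_mem_interior_crossingTriangle hc₁) with h1 | h1
      · simp only [Set.mem_ofPred_eq] at h1
        linarith
      · simp only [Set.mem_ofPred_eq] at h1
        linarith
    · refine ⟨2, hU.subset_of_interior_subset (isClosed_strip _ _ _ _ _) fun z hz => ?_⟩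
      have hz1 := hside z (interior_subset hz)
      obtain ⟨h1, h2, h3, h4⟩ := mem_rect.1 (hsub (interior_subset hz))
      refine mem_strip_zero.2 ⟨h1, hz1, ?_, h4⟩
      rcases hs hz with h5 | h5
      · exact le_of_lt h5
      · simp only [Set.mem_ofPred_eq] at h5
        linarith [key z.1]
    · refine ⟨3, hU.subset_of_interior_subset (isClosed_strip _ _ _ _ _) fun z hz => ?_⟩
      have hz1 := hside z (interior_subset hz)
      obtain ⟨h1, h2, h3, h4⟩ := mem_rect.1 (hsub (interior_subset hz))
      refine mem_strip_one.2 ⟨hz1, h2, ?_, h4⟩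
      rcases hs hz with h5 | h5
      · simp only [Set.mem_ofPred_eq] at h5
        linarith [key z.1]
      · exact le_of_lt h5

lemma IsTiling.crossingTriangle_mem {T : Set (Set (ℝ × ℝ))} (h : IsTiling (rect n) T)
    (hc : 2 * c = a + b + 1) (ha : 0 ≤ a) (hb : 0 ≤ b) (han : a ≤ n) (hbn : b ≤ n)
    (hT : ∀ Δ ∈ T, ∃ i, Δ ⊆ pieces n a b c i) : crossingTriangle a b c ∈ T := by
  refine h.mem_of_subset_or_null (isUnimodularTriangle_crossingTriangle hc)
    (pieces_subset hc ha hb han hbn 1) fun Δ hΔ => ?_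
  obtain ⟨i, hi⟩ := hT Δ hΔ
  by_cases e : i = 1
  · subst e
    exact Or.inl hi
  · exact Or.inr (measure_mono_null (Set.inter_subset_inter_left _ hi)
      (volume_pieces_inter (n := n) hc e))

lemma not_crossingTriangle_subset_strip_zero {s t s' t' : ℤ} :
    ¬ crossingTriangle a b c ⊆ strip 0 s t s' t' := by
  intro h
  have := (h (mem_convexHull_triple_middle _ _ _)).2.1
  norm_num at this

lemma not_crossingTriangle_subset_strip_one {s t s' t' : ℤ} :
    ¬ crossingTriangle a b c ⊆ strip 1 s t s' t' := by
  intro h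
  have := (h (mem_convexHull_triple_left _ _ _)).1
  norm_num at this

lemma eq_or_lt_of_crossingTriangle_subset_pieces {a' b' c' : ℤ} (hc : 2 * c = a + b + 1)
    (hc' : 2 * c' = a' + b' + 1) {i : Fin 4} (h : crossingTriangle a b c ⊆ pieces n a' b' c' i) :
    (a = a' ∧ b = b') ∨ a + b < a' + b' := by
  fin_cases i
  · right
    have h1 := (h (mem_convexHull_triple_right _ _ _)).2.2.2
    dsimp only at h1
    have h2 : 2 * (c : ℝ) ≤ a' + b' := by linarith
    have h2 : 2 * c ≤ a' + b' := by exact_mod_cast h2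
    omega
  · left
    have h1 := (mem_crossingTriangle_upper hc').1 (h (mem_convexHull_triple_left _ _ _))
    have h2 := (mem_crossingTriangle_upper hc').1 (h (mem_convexHull_triple_middle _ _ _))
    dsimp only at h1 h2
    obtain ⟨h11, h12, -⟩ := h1
    obtain ⟨h21, -, h22⟩ := h2
    have e1 : (a' : ℝ) ≤ a := by linarith
    have e2 : (a : ℝ) ≤ a' := by linarith
    have e3 : (b' : ℝ) ≤ b := by linarith
    have e4 : (b : ℝ) ≤ b' := by linarith
    have e1 : a' ≤ a := by exact_mod_cast e1
    have e2 : a ≤ a' := by exact_mod_cast e2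
    have e3 : b' ≤ b := by exact_mod_cast e3
    have e4 : b ≤ b' := by exact_mod_cast e4
    omega
  · exact absurd h not_crossingTriangle_subset_strip_zero
  · exact absurd h not_crossingTriangle_subset_strip_one

end Pieces

/-- The tilings of `[0, 2] × [0, n]` whose topmost crossing triangle has base endpoints
`(0, A)` and `(2, B)`. -/
def topFamily (n : ℕ) (p : ℕ × ℕ) : Set (Set (Set (ℝ × ℝ))) :=
  {T | IsTiling (rect n) T ∧
    ∀ Δ ∈ T, ∃ i, Δ ⊆ pieces n p.1 p.2 ((p.1 + p.2 + 1) / 2 : ℕ) i}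

/-- The tilings of `[0, 2] × [0, n]` without crossing triangles. -/
def splitFamily (n : ℕ) : Set (Set (Set (ℝ × ℝ))) :=
  {T | IsTiling (rect n) T ∧
    ∀ Δ ∈ T, ∃ i, Δ ⊆ (![strip 0 0 0 n n, strip 1 0 0 n n] : Fin 2 → Set (ℝ × ℝ)) i}

/-- The positions of the base endpoints of a crossing triangle in `[0, 2] × [0, n]`. -/
def crossingIndex (n : ℕ) : Finset (ℕ × ℕ) :=
  (Finset.range (n + 1) ×ˢ Finset.range (n + 1)).filter fun p => (p.1 + p.2) % 2 = 1

section Count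

variable {n : ℕ}

lemma mem_crossingIndex {p : ℕ × ℕ} :
    p ∈ crossingIndex n ↔ p.1 ≤ n ∧ p.2 ≤ n ∧ (p.1 + p.2) % 2 = 1 := by
  simp only [crossingIndex, Finset.mem_filter, Finset.mem_product, Finset.mem_range]
  omega

lemma two_mul_apex {p : ℕ × ℕ} (hp : (p.1 + p.2) % 2 = 1) :
    2 * (((p.1 + p.2 + 1) / 2 : ℕ) : ℤ) = (p.1 : ℤ) + p.2 + 1 := by
  omega

lemma ncard_splitFamily (n : ℕ) : (splitFamily n).ncard = (Nat.choose (2 * n) n) ^ 2 := by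
  have := card_tilings_compatible (P := rect n)
    ![strip 0 0 0 n n, strip 1 0 0 n n] ?_ ?_ ?_
  · rw [Fin.prod_univ_two] at this
    simp only [Matrix.cons_val_zero, Matrix.cons_val_one] at this
    rw [splitFamily, ← Nat.card_coe_set_eq]
    have h0 := numTilings_strip 0 0 0 n n
    have h1 := numTilings_strip 1 0 0 n n
    rw [zero_add] at h0 h1
    rw [h0, h1, ← two_mul, ← sq] at this
    exact this
  · intro i
    fin_cases i
    · intro z hz
      obtain ⟨h1, h2, h3, h4⟩ := mem_strip_zero.1 hz
      push_cast at h3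
      exact mem_rect.2 ⟨h1, by linarith, by linarith, h4⟩
    · intro z hz
      obtain ⟨h1, h2, h3, h4⟩ := mem_strip_one.1 hz
      push_cast at h3
      exact mem_rect.2 ⟨by linarith, by linarith, by linarith, h4⟩
  · intro z hz
    obtain ⟨h1, h2, h3, h4⟩ := mem_rect.1 hz
    rw [Set.mem_iUnion]
    rcases le_total z.1 1 with h | h
    · exact ⟨0, mem_strip_zero.2 ⟨h1, h, by push_cast; linarith, h4⟩⟩
    · exact ⟨1, mem_strip_one.2 ⟨h, h2, by push_cast; linarith, h4⟩⟩
  · have h01 : volume (strip 0 0 0 n n ∩ strip 1 0 0 n n) = 0 := by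
      refine measure_mono_null ?_ (volume_line (a := 1) (b := 0) (c := 1) (by simp))
      rintro z ⟨h1, h2⟩
      have h1 := (mem_strip_zero.1 h1).2.1
      have h2 := (mem_strip_one.1 h2).1
      simp only [Set.mem_ofPred_eq]
      linarith
    intro i j hij
    fin_cases i <;> fin_cases j <;>
      first
      | exact absurd rfl hij
      | exact h01
      | (rw [Set.inter_comm]; exact h01)

lemma ncard_topFamily {p : ℕ × ℕ} (hp : p ∈ crossingIndex n) :
    (topFamily n p).ncard = g₂ p.1 p.2 *
      Nat.choose (2 * n - (3 * p.1 + p.2 + 1) / 2) (n - p.1) *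
      Nat.choose (2 * n - (p.1 + 3 * p.2 + 1) / 2) (n - p.2) := by
  obtain ⟨A, B⟩ := p
  obtain ⟨hA, hB, hodd⟩ := mem_crossingIndex.1 hp
  dsimp only at hA hB hodd ⊢
  have hc := two_mul_apex (p := (A, B)) hodd
  dsimp only at hc
  have := card_tilings_compatible (P := rect n) (pieces n A B ((A + B + 1) / 2 : ℕ))
    (pieces_subset hc (by omega) (by omega) (by omega) (by omega)) (pieces_cover hc)
    fun i j hij => volume_pieces_inter hc hij
  rw [topFamily, ← Nat.card_coe_set_eq]
  refine this.trans ?_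
  obtain ⟨M, hM⟩ : ∃ M, M = (A + B + 1) / 2 := ⟨_, rfl⟩
  rw [← hM] at hc ⊢
  have h0 := numTilings_strip 0 A M (n - A) (n - M)
  have h1 := numTilings_strip 1 M B (n - M) (n - B)
  have eA : (A : ℤ) + (n - A : ℕ) = n := by omega
  have eB : (B : ℤ) + (n - B : ℕ) = n := by omega
  have eM : (M : ℤ) + (n - M : ℕ) = n := by omega
  rw [eA, eM] at h0
  rw [eB, eM, Nat.choose_symm_add] at h1
  have e0 : n - A + (n - M) = 2 * n - (3 * A + B + 1) / 2 := by omega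
  have e1 : n - M + (n - B) = 2 * n - (A + 3 * B + 1) / 2 := by omega
  rw [e0] at h0
  rw [e1] at h1
  have h2 := numTilings_triangle (isUnimodularTriangle_crossingTriangle hc)
  rw [g₂_eq_numTilings (by omega), ← h0, ← h1, Fin.prod_univ_four]
  change _ * numTilings (crossingTriangle A B M) * _ * _ = _
  rw [h2, mul_one]
  rfl

lemma crossingTriangle_mem_of_mem_topFamily {p : ℕ × ℕ} (hp : p ∈ crossingIndex n)
    {T : Set (Set (ℝ × ℝ))} (hT : T ∈ topFamily n p) :
    crossingTriangle p.1 p.2 ((p.1 + p.2 + 1) / 2 : ℕ) ∈ T := by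
  obtain ⟨hA, hB, hodd⟩ := mem_crossingIndex.1 hp
  exact hT.1.crossingTriangle_mem (two_mul_apex hodd) (by omega) (by omega) (by omega)
    (by omega) hT.2

lemma pairwiseDisjoint_topFamily (n : ℕ) :
    (crossingIndex n : Set (ℕ × ℕ)).PairwiseDisjoint (topFamily n) := by
  intro p hp q hq hne
  rw [Function.onFun, Set.disjoint_left]
  intro T hTp hTq
  obtain ⟨i, hi⟩ := hTq.2 _ (crossingTriangle_mem_of_mem_topFamily hp hTp)
  obtain ⟨j, hj⟩ := hTp.2 _ (crossingTriangle_mem_of_mem_topFamily hq hTq)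
  have hcp := two_mul_apex (mem_crossingIndex.1 hp).2.2
  have hcq := two_mul_apex (mem_crossingIndex.1 hq).2.2
  have h1 := eq_or_lt_of_crossingTriangle_subset_pieces hcp hcq hi
  have h2 := eq_or_lt_of_crossingTriangle_subset_pieces hcq hcp hj
  exact hne (Prod.ext (by omega) (by omega))

lemma disjoint_splitFamily_topFamily (n : ℕ) :
    Disjoint (splitFamily n) (⋃ p ∈ crossingIndex n, topFamily n p) := by
  rw [Set.disjoint_left]
  intro T hT hT'
  simp only [Set.mem_iUnion] at hT'
  obtain ⟨p, hp, hT'⟩ := hT'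
  obtain ⟨i, hi⟩ := hT.2 _ (crossingTriangle_mem_of_mem_topFamily hp hT')
  fin_cases i
  · exact not_crossingTriangle_subset_strip_zero hi
  · exact not_crossingTriangle_subset_strip_one hi

lemma isTiling_rect_eq_union (hn : 1 ≤ n) : {T | IsTiling (rect n) T} =
    splitFamily n ∪ ⋃ p ∈ crossingIndex n, topFamily n p := by
  ext T
  simp only [Set.mem_union, Set.mem_iUnion]
  constructor
  · intro h
    have h : IsTiling (rect n) T := h
    by_cases hex : ∃ a b c : ℤ, (2 * c = a + b + 1 ∨ 2 * c + 1 = a + b) ∧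
        crossingTriangle a b c ∈ T
    · right
      obtain ⟨a, b, c, hc, hT, hmax⟩ := h.exists_top_crossing hn hex
      have h1 := mem_rect.1 (h.subset _ hT (mem_convexHull_triple_left _ _ _))
      have h2 := mem_rect.1 (h.subset _ hT (mem_convexHull_triple_middle _ _ _))
      obtain ⟨-, -, ha0, han⟩ := h1
      obtain ⟨-, -, hb0, hbn⟩ := h2
      dsimp only at ha0 han hb0 hbn
      have ha0 : 0 ≤ a := by exact_mod_cast ha0
      have hb0 : 0 ≤ b := by exact_mod_cast hb0
      lift a to ℕ using ha0
      lift b to ℕ using hb0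
      have han : a ≤ n := by exact_mod_cast han
      have hbn : b ≤ n := by exact_mod_cast hbn
      obtain rfl : c = ((a + b + 1) / 2 : ℕ) := by omega
      exact ⟨(a, b), mem_crossingIndex.2 ⟨han, hbn, by dsimp only; omega⟩, h,
        h.exists_subset_pieces hc hT hmax⟩
    · left
      refine ⟨h, fun Δ hΔ => ?_⟩
      have hsub := h.subset Δ hΔ
      rcases (h.isUnimodularTriangle Δ hΔ).crossing_or_le_or_ge
        (fun z hz => ⟨(mem_rect.1 (hsub hz)).1, (mem_rect.1 (hsub hz)).2.1⟩) with
        ⟨a, b, c, hc, rfl⟩ | hside | hside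
      · exact absurd ⟨a, b, c, hc, hΔ⟩ hex
      · refine ⟨0, fun z hz => ?_⟩
        obtain ⟨h1, h2, h3, h4⟩ := mem_rect.1 (hsub hz)
        exact mem_strip_zero.2 ⟨h1, hside z hz, by push_cast; linarith, h4⟩
      · refine ⟨1, fun z hz => ?_⟩
        obtain ⟨h1, h2, h3, h4⟩ := mem_rect.1 (hsub hz)
        exact mem_strip_one.2 ⟨hside z hz, h2, by push_cast; linarith, h4⟩
  · rintro (h | ⟨p, -, h⟩)
    · exact h.1
    · exact h.1

lemma ncard_isTiling_rect (hn : 1 ≤ n) : numTilings (rect n) =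
    (splitFamily n).ncard + ∑ p ∈ crossingIndex n, (topFamily n p).ncard := by
  have hfin := finite_isTiling_rect n
  have hfinp : ∀ p ∈ crossingIndex n, (topFamily n p).Finite :=
    fun p _ => hfin.subset fun T hT => hT.1
  rw [numTilings_eq_ncard, isTiling_rect_eq_union hn,
    Set.ncard_union_eq (disjoint_splitFamily_topFamily n) (hfin.subset fun T hT => hT.1)
      (hfin.subset fun T hT => by
        simp only [Set.mem_iUnion] at hT
        obtain ⟨p, -, h⟩ := hT
        exact h.1)]
  congr 1
  have := Set.Finite.ncard_biUnion (crossingIndex n).finite_toSet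
    (fun p hp => hfinp p hp) (pairwiseDisjoint_topFamily n)
  rw [finsum_mem_coe_finset] at this
  exact this

/-- A symmetric sum over the index set reduces to the positions with `A < B`. -/
lemma sum_crossingIndex (w : ℕ → ℕ → ℕ)
    (hw : ∀ A B, (A + B) % 2 = 1 → w A B = w B A) :
    ∑ p ∈ crossingIndex n, w p.1 p.2 =
      2 * ∑ A ∈ Finset.range (n + 1), ∑ B ∈ Finset.range (n + 1),
        (if A < B ∧ (A + B) % 2 = 1 then w A B else 0) := by
  rw [crossingIndex, Finset.sum_filter, Finset.sum_product]
  have hsplit : ∀ A B, (if (A + B) % 2 = 1 then w A B else 0) =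
      (if A < B ∧ (A + B) % 2 = 1 then w A B else 0) +
        (if B < A ∧ (B + A) % 2 = 1 then w B A else 0) := by
    intro A B
    by_cases h : (A + B) % 2 = 1
    · have h' : (B + A) % 2 = 1 := by omega
      rcases lt_trichotomy A B with hl | rfl | hl
      · simp [h, hl, not_lt_of_gt hl]
      · omega
      · simp [h, h', hl, not_lt_of_gt hl, hw A B h]
    · have h' : ¬ (B + A) % 2 = 1 := by omega
      simp [h, h']
  simp only [hsplit, Finset.sum_add_distrib]
  rw [two_mul]
  congr 1
  exact Finset.sum_comm

end Count

/-- The "quadratic" recursion expressing `f(2,n)` in terms of `g₂`. -/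
theorem f_two_n (n : ℕ) (hn : 1 ≤ n) :
    f 2 n = (Nat.choose (2 * n) n) ^ 2 +
      2 * ∑ A ∈ Finset.range (n + 1), ∑ B ∈ Finset.range (n + 1),
        (if A < B ∧ (A + B) % 2 = 1 then
          g₂ A B * Nat.choose (2 * n - (3 * A + B + 1) / 2) (n - A) *
            Nat.choose (2 * n - (A + 3 * B + 1) / 2) (n - B)
        else 0) := by
  have hf : f 2 n = numTilings (rect n) :=
    numTriangulations_eq_numTilings (convex_rect n) (interior_rect_nonempty hn)
  rw [hf, ncard_isTiling_rect hn, ncard_splitFamily,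
    Finset.sum_congr rfl fun p hp => ncard_topFamily hp]
  congr 1
  refine sum_crossingIndex (fun A B => g₂ A B * Nat.choose (2 * n - (3 * A + B + 1) / 2) (n - A) *
    Nat.choose (2 * n - (A + 3 * B + 1) / 2) (n - B)) fun A B hAB => ?_
  rw [g₂_comm (by omega), mul_right_comm, add_comm A (3 * B), add_comm (3 * A) B]
end
end
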